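/- Exact weighted Euler–Maclaurin for regular integral polytopes and polynomials: Let Δ ⊂ ℝ^n be a regular integral polytope with facet normals u_1,…,u_d and facet constants μ_1,…,μ_d, let q ∈ ℂ, and let p : ℝ^n → ℂ be a polynomial. Then the function H(h) := ∫_{Δ(h)} p(x) dx agrees with a polynomial in h = (h_1,…,h_d) on some neighborhood of 0 in ℝ^d, and for every integer K with 2K ≥ deg p + n + 1, Σ_{x ∈ Δ ∩ ℤ^n} q^{c(x)} p(x) = [Π_{i=1}^d χ_q^{2K}(∂/∂h_i)] H(h) |_{h=0}. -/

import Mathlib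

open scoped BigOperators Classical
open MeasureTheory

/-- The standard pairing `⟨w, x⟩ = ∑ j, w j * x j` between an integer vector and a
real vector. -/
def intPair {n : ℕ} (w : Fin n → ℤ) (x : Fin n → ℝ) : ℝ := ∑ j, (w j : ℝ) * x j

/-- Coefficients of the Todd power series `Td(S) = S/(1-e^{-S}) = ∑ bernoulli' n · Sⁿ/n!`. -/
noncomputable def toddCoeff (j : ℕ) : ℂ := (bernoulli' j : ℂ) / j.factorial

/-- Coefficients of the Hirzebruch power series `χ_q(S) = q·Td(S) + (1-q)·Td(-S)`. -/
noncomputable def chiCoeff (q : ℂ) (j : ℕ) : ℂ :=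
  q * toddCoeff j + (1 - q) * (-1) ^ j * toddCoeff j

/-- The partial derivative in the `i`-th coordinate direction. -/
noncomputable def coordPartial {n : ℕ} (i : Fin n)
    (H : (Fin n → ℝ) → ℂ) : (Fin n → ℝ) → ℂ :=
  fun x => fderiv ℝ H x (Pi.single i 1)

/-- The mixed partial derivative `∂^{j₁}_{h₁} ⋯ ∂^{jₙ}_{hₙ} H`. -/
noncomputable def mixedPartial {n : ℕ} (j : Fin n → ℕ)
    (H : (Fin n → ℝ) → ℂ) : (Fin n → ℝ) → ℂ :=
  (List.finRange n).foldr (fun i G => (coordPartial i)^[j i] G) H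

section PolarDecomposition

variable {κ ι E : Type*} [Fintype κ] [DecidableEq κ]

/-- The defect, at the face `J`, of the polar decomposition of a simple polytope whose vertices
`v ∈ V` lie on the facets `I v`.  The number `c v i` is the slope at `v` of the polarizing
functional along the edge leaving the facet `i`, and `b i` is the weight of the facet inequality
`i` at the point under consideration. -/
noncomputable def polarDefect (V : Finset ι) (I : ι → Finset κ) (c : ι → κ → ℝ)
    (J : Finset κ) (b : κ → ℂ) : ℂ :=
  ∑ v ∈ V with J ⊆ I v, ∏ i ∈ I v \ J, (if 0 < c v i then b i else b i - 1) - ∏ i ∈ Jᶜ, b i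

theorem polarDefect_sub_polarDefect (V : Finset ι) (I : ι → Finset κ) (c : ι → κ → ℝ)
    {J : Finset κ} {k : κ} (hk : k ∉ J) {b b' : κ → ℂ} (hb : ∀ i, i ≠ k → b i = b' i) :
    polarDefect V I c J b - polarDefect V I c J b' =
      (b k - b' k) * polarDefect V I c (insert k J) b := by
  unfold polarDefect
  rw [sub_sub_sub_comm, mul_sub]
  have hprod : ∏ i ∈ Jᶜ, b i - ∏ i ∈ Jᶜ, b' i = (b k - b' k) * ∏ i ∈ (insert k J)ᶜ, b i := by
    have hJ : Jᶜ = insert k (insert k J)ᶜ := by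
      ext i; by_cases hi : i = k <;> simp [hi, hk]
    have hkJ : k ∉ (insert k J)ᶜ := by simp
    rw [hJ, Finset.prod_insert hkJ, Finset.prod_insert hkJ, sub_mul]
    congr 2
    refine Finset.prod_congr rfl fun i hi => (hb i ?_).symm
    rintro rfl; exact hkJ hi
  rw [hprod]
  congr 1
  rw [Finset.sum_filter, Finset.sum_filter, Finset.sum_filter, ← Finset.sum_sub_distrib,
    Finset.mul_sum]
  refine Finset.sum_congr rfl fun v _ => ?_
  by_cases hJ : J ⊆ I v
  · by_cases hkv : k ∈ I v
    · have hins : insert k J ⊆ I v := Finset.insert_subset hkv hJ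
      have hsplit : I v \ J = insert k (I v \ insert k J) := by
        ext i; by_cases hi : i = k <;> simp [hi, hk, hkv]
      have hnot : k ∉ I v \ insert k J := by simp
      rw [if_pos hJ, if_pos hJ, if_pos hins, hsplit, Finset.prod_insert hnot,
        Finset.prod_insert hnot]
      have hrest : ∏ i ∈ I v \ insert k J, (if 0 < c v i then b' i else b' i - 1) =
          ∏ i ∈ I v \ insert k J, (if 0 < c v i then b i else b i - 1) := by
        refine Finset.prod_congr rfl fun i hi => ?_
        rw [hb i]
        rintro rfl; exact hnot hi
      rw [hrest, ← sub_mul]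
      congr 1
      split_ifs <;> ring
    · have hins : ¬ insert k J ⊆ I v := fun h => hkv (h (Finset.mem_insert_self _ _))
      rw [if_pos hJ, if_pos hJ, if_neg hins, mul_zero, sub_eq_zero]
      refine Finset.prod_congr rfl fun i hi => ?_
      rw [hb i]
      rintro rfl; exact hkv (Finset.mem_sdiff.1 hi).1
  · have hins : ¬ insert k J ⊆ I v := fun h => hJ ((Finset.subset_insert _ _).trans h)
    rw [if_neg hJ, if_neg hJ, if_neg hins]; simp

variable [AddCommGroup E] [Module ℝ E]

/-- **Weighted polar decomposition.** Let `Y` be the set of vectors of facet slacks of the points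
of the ambient space of a simple polytope.  At a point with slack vector `y` on the face `J`, with
facet weights `b` equal to `1` where the slack is positive and to `0` where it is negative, the
weight of the polytope is the signed sum of the weights of the polarized vertex cones. -/
theorem polarDefect_eq_zero (V : Finset ι) (I : ι → Finset κ) (c : ι → κ → ℝ)
    (ℓ : E →ₗ[ℝ] κ → ℝ) (ζ : E →ₗ[ℝ] ℝ) (α : ι → κ → E) (Y : Set (κ → ℝ))
    (htrans : ∀ y ∈ Y, ∀ z, y + ℓ z ∈ Y)
    (hface : ∀ y ∈ Y, (∀ i, 0 ≤ y i) → ∀ J : Finset κ, (∀ j ∈ J, y j = 0) → ∃ v ∈ V, J ⊆ I v)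
    (hvert : ∀ v ∈ V, ∀ y ∈ Y, (∀ j ∈ I v, y j = 0) → ∀ i ∉ I v, 0 < y i)
    (hanti : ∀ v ∈ V, ∀ v' ∈ V, I v ⊆ I v' → v = v')
    (hrec : ∀ z, z ≠ 0 → ∃ i, 0 < ℓ z i)
    (hdual : ∀ v ∈ V, ∀ k ∈ I v, ∀ i ∈ I v, ℓ (α v k) i = if i = k then 1 else 0)
    (hslope : ∀ v ∈ V, ∀ z, ζ z = ∑ i ∈ I v, ℓ z i * c v i)
    (hc : ∀ v ∈ V, ∀ k ∈ I v, c v k ≠ 0)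
    (J : Finset κ) (y : κ → ℝ) (hy : y ∈ Y) (hJ : ∀ j ∈ J, y j = 0) (b : κ → ℂ)
    (hb : ∀ i ∉ J, (0 < y i → b i = 1) ∧ (y i < 0 → b i = 0)) :
    polarDefect V I c J b = 0 := by
  induction hN : Jᶜ.card using Nat.strong_induction_on generalizing J y b with
  | _ N ih =>
  subst hN
  by_cases hex : ∃ v ∈ V, J ⊆ I v
  swap
  · have hempty : V.filter (fun v => J ⊆ I v) = ∅ := by
      rw [Finset.filter_eq_empty_iff]
      exact fun v hv h => hex ⟨v, hv, h⟩
    rw [polarDefect, hempty, Finset.sum_empty, zero_sub, neg_eq_zero]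
    by_contra hne
    refine hex (hface y hy (fun i => ?_) J hJ)
    by_cases hi : i ∈ J
    · exact (hJ i hi).ge
    · by_contra hlt
      exact Finset.prod_ne_zero_iff.1 hne i (by simpa using hi) ((hb i hi).2 (not_le.1 hlt))
  obtain ⟨v, hv, hJv⟩ := hex
  by_cases hIv : I v ⊆ J
  · obtain rfl : I v = J := Finset.Subset.antisymm hIv hJv
    have hsingle : V.filter (fun v' => I v ⊆ I v') = {v} := by
      ext v'
      simp only [Finset.mem_filter, Finset.mem_singleton]
      constructor
      · exact fun h => (hanti v hv v' h.1 h.2).symm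
      · rintro rfl; exact ⟨hv, subset_rfl⟩
    rw [polarDefect, hsingle, Finset.sum_singleton, Finset.sdiff_self, Finset.prod_empty,
      Finset.prod_eq_one, sub_self]
    intro i hi
    rw [Finset.mem_compl] at hi
    exact (hb i hi).1 (hvert v hv y hy hJ i hi)
  obtain ⟨k, hkv, hkJ⟩ := Finset.not_subset.1 hIv
  obtain ⟨η, hηpos, hηJ⟩ : ∃ η, 0 < ζ η ∧ ∀ j ∈ J, ℓ η j = 0 := by
    have hζ : ζ (α v k) = c v k := by
      rw [hslope v hv, Finset.sum_eq_single k]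
      · rw [hdual v hv k hkv k hkv, if_pos rfl, one_mul]
      · intro i hi hik
        rw [hdual v hv k hkv i hi, if_neg hik, zero_mul]
      · exact fun h => absurd hkv h
    have hzero : ∀ j ∈ J, ℓ (α v k) j = 0 := by
      intro j hj
      rw [hdual v hv k hkv j (hJv hj), if_neg]
      rintro rfl; exact hkJ hj
    rcases (hc v hv k hkv).lt_or_gt with hneg | hpos
    · exact ⟨-α v k, by rw [map_neg, hζ]; linarith, fun j hj => by simp [hzero j hj]⟩
    · exact ⟨α v k, by rw [hζ]; exact hpos, hzero⟩
  have hη : η ≠ 0 := by rintro rfl; simp at hηpos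
  -- the weights met far away along the direction `-η`
  let far : κ → ℂ := fun i => if 0 < ℓ η i then 0 else 1
  let K : Finset κ := Finset.univ.filter fun i => ℓ η i ≠ 0
  let s : κ → ℝ := fun i => y i / ℓ η i
  let mix : Finset κ → κ → ℂ := fun T i => if i ∈ K \ T then far i else b i
  have hKJ : ∀ i ∈ K, i ∉ J := fun i hi hiJ => (Finset.mem_filter.1 hi).2 (hηJ i hiJ)
  have hmix : ∀ T : Finset κ, T ⊆ K → (∀ i ∈ T, ∀ j ∈ K \ T, s j ≤ s i) →
      polarDefect V I c J (mix T) = 0 := by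
    intro T
    induction T using Finset.induction_on_min_value s with
    | empty =>
      intro _ _
      have hprod : ∏ i ∈ Jᶜ, mix ∅ i = 0 := by
        obtain ⟨i, hi⟩ := hrec η hη
        have hiK : i ∈ K := by simp [K, hi.ne']
        exact Finset.prod_eq_zero (i := i) (by simpa using hKJ i hiK)
          (by simp [mix, hiK, far, hi])
      rw [polarDefect, hprod, sub_zero]
      refine Finset.sum_eq_zero fun w hw => ?_
      rw [Finset.mem_filter] at hw
      by_contra hne
      rw [← ne_eq, Finset.prod_ne_zero_iff] at hne
      have hle : ζ η ≤ 0 := by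
        rw [hslope w hw.1]
        refine Finset.sum_nonpos fun i hi => ?_
        by_cases hz : ℓ η i = 0
        · simp [hz]
        have hiK : i ∈ K := by simp [K, hz]
        have := hne i (Finset.mem_sdiff.2 ⟨hi, hKJ i hiK⟩)
        by_cases hci : 0 < c w i
        · by_cases hli : 0 < ℓ η i
          · simp [mix, hiK, far, hli, hci] at this
          · exact mul_nonpos_of_nonpos_of_nonneg (not_lt.1 hli) hci.le
        · by_cases hli : 0 < ℓ η i
          · exact mul_nonpos_of_nonneg_of_nonpos hli.le (not_lt.1 hci)
          · simp [mix, hiK, far, hli, hci] at this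
      exact absurd hηpos (not_lt.2 hle)
    | insert a T haT hmin ihT =>
      intro hsub hord
      have haK : a ∈ K := hsub (Finset.mem_insert_self _ _)
      have hTK : T ⊆ K := (Finset.subset_insert _ _).trans hsub
      have hηa : ℓ η a ≠ 0 := (Finset.mem_filter.1 haK).2
      have haJ := hKJ a haK
      have hT0 : polarDefect V I c J (mix T) = 0 := by
        refine ihT hTK fun i hi j hj => ?_
        by_cases hja : j = a
        · subst hja; exact hmin i hi
        · exact hord i (Finset.mem_insert_of_mem hi) j (by
            simp only [Finset.mem_sdiff, Finset.mem_insert] at hj ⊢; tauto)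
      have hoff : ∀ i, i ≠ a → mix (insert a T) i = mix T i := by
        intro i hi; simp [mix, hi]
      have hstep := polarDefect_sub_polarDefect V I c haJ hoff
      rw [hT0, sub_zero] at hstep
      rw [hstep]
      have hma : mix (insert a T) a = b a := by simp [mix]
      have hma' : mix T a = far a := by simp [mix, haK, haT]
      by_cases hneg : s a < 0
      · have : b a = far a := by
          have hba := hb a haJ
          simp only [s, far] at hneg ⊢
          rcases hηa.lt_or_gt with h | h
          · rw [if_neg h.not_gt]
            exact hba.1 (by by_contra h0; exact absurd hneg (not_lt.2 (div_nonneg_of_nonpos (not_lt.1 h0) h.le)))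
          · rw [if_pos h]
            exact hba.2 (by by_contra h0; exact absurd hneg (not_lt.2 (div_nonneg (not_lt.1 h0) h.le)))
        rw [hma, hma', this, sub_self, zero_mul]
      have hsa : 0 ≤ s a := not_lt.1 hneg
      have hcard : ((insert a J)ᶜ).card < (Jᶜ).card := by
        apply Finset.card_lt_card
        rw [Finset.ssubset_iff_of_subset (Finset.compl_subset_compl.2 (Finset.subset_insert _ _))]
        exact ⟨a, by simpa using haJ, by simp⟩
      have hys : ∀ i, ℓ η i ≠ 0 → y i = s i * ℓ η i := fun i hi => by
        simp only [s]; field_simp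
      rw [ih _ hcard (insert a J) (y + ℓ (-(s a) • η)) (htrans y hy _) ?_ _ ?_ rfl, mul_zero]
      · intro j hj
        rcases Finset.mem_insert.1 hj with rfl | hj
        · simp only [Pi.add_apply, map_smul, Pi.smul_apply, smul_eq_mul]
          rw [hys j hηa]; ring
        · simp [hJ j hj, hηJ j hj]
      · intro i hi
        rw [Finset.mem_insert, not_or] at hi
        have hbi := hb i hi.2
        rw [hoff i hi.1]
        simp only [Pi.add_apply, map_smul, Pi.smul_apply, smul_eq_mul]
        by_cases hz : ℓ η i = 0
        · have : mix T i = b i := by simp [mix, K, hz]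
          rw [this, hz]; simpa using hbi
        have hiK : i ∈ K := by simp [K, hz]
        have hyi := hys i hz
        by_cases hiT : i ∈ T
        · have : mix T i = b i := by simp [mix, hiT]
          rw [this]
          have hsi := hmin i hiT
          constructor
          · intro h
            refine hbi.1 ?_
            rcases lt_or_gt_of_ne hz with hl | hl <;> nlinarith
          · intro h
            refine hbi.2 ?_
            rcases lt_or_gt_of_ne hz with hl | hl <;> nlinarith
        · have : mix T i = far i := by simp [mix, hiK, hiT]
          rw [this]
          have hsi : s i ≤ s a := hord a (Finset.mem_insert_self _ _) i (by simp [hiK, hiT, hi.1])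
          simp only [far]
          constructor
          · intro h
            rw [if_neg]
            intro hl; nlinarith
          · intro h
            rw [if_pos]
            by_contra hl
            have := lt_of_le_of_ne (not_lt.1 hl) hz
            nlinarith
  have hfull := hmix K subset_rfl (by simp)
  have : mix K = b := by funext i; simp [mix]
  rwa [this] at hfull

end PolarDecomposition

section AsymptoticExpansion

open Filter Topology Asymptotics

/-- `F` has the asymptotic expansion `φ` at `0⁺`. -/
def HasExpansion (F : ℝ → ℂ) (φ : PowerSeries ℂ) : Prop :=
  ∀ N : ℕ, ∃ P : Polynomial ℂ, PowerSeries.X ^ N ∣ φ - (P : PowerSeries ℂ) ∧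
    (fun t : ℝ => F t - P.eval (t : ℂ)) =O[𝓝[>] 0] fun t : ℝ => t ^ N

theorem isBigO_eval_one (P : Polynomial ℂ) :
    (fun t : ℝ => P.eval (t : ℂ)) =O[𝓝[>] 0] fun _ : ℝ => (1 : ℝ) := by
  have h : Continuous fun t : ℝ => P.eval (t : ℂ) := P.continuous.comp Complex.continuous_ofReal
  exact (h.tendsto 0).isBigO_one ℝ |>.mono nhdsWithin_le_nhds

theorem isBigO_eval_of_X_pow_dvd {P : Polynomial ℂ} {N : ℕ}
    (h : (PowerSeries.X : PowerSeries ℂ) ^ N ∣ (P : PowerSeries ℂ)) :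
    (fun t : ℝ => P.eval (t : ℂ)) =O[𝓝[>] 0] fun t : ℝ => t ^ N := by
  have hdvd : Polynomial.X ^ N ∣ P := by
    rw [Polynomial.X_pow_dvd_iff]
    intro m hm
    simpa using PowerSeries.X_pow_dvd_iff.1 h m hm
  obtain ⟨Q, rfl⟩ := hdvd
  have hpow : (fun t : ℝ => (t : ℂ) ^ N) =O[𝓝[>] 0] fun t : ℝ => t ^ N :=
    IsBigO.of_bound 1 (Eventually.of_forall fun t => by simp)
  simpa using hpow.mul (isBigO_eval_one Q)

theorem X_pow_dvd_of_isBigO_eval {P : Polynomial ℂ} {N : ℕ}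
    (h : (fun t : ℝ => P.eval (t : ℂ)) =O[𝓝[>] 0] fun t : ℝ => t ^ N) :
    Polynomial.X ^ N ∣ P := by
  induction N generalizing P with
  | zero => simp
  | succ N ih =>
    have hcont : Tendsto (fun t : ℝ => P.eval (t : ℂ)) (𝓝[>] 0) (𝓝 (P.eval 0)) := by
      have h : Continuous fun t : ℝ => P.eval (t : ℂ) :=
        P.continuous.comp Complex.continuous_ofReal
      simpa using (h.tendsto 0).mono_left nhdsWithin_le_nhds
    have hzero : Tendsto (fun t : ℝ => P.eval (t : ℂ)) (𝓝[>] 0) (𝓝 0) := by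
      refine h.trans_tendsto ?_
      have h : Continuous fun t : ℝ => t ^ (N + 1) := by fun_prop
      simpa using (h.tendsto 0).mono_left nhdsWithin_le_nhds
    have hroot : P.eval 0 = 0 := tendsto_nhds_unique hcont hzero
    obtain ⟨Q, rfl⟩ : Polynomial.X ∣ P := by
      rw [Polynomial.X_dvd_iff, Polynomial.coeff_zero_eq_eval_zero, hroot]
    rw [pow_succ']
    refine mul_dvd_mul_left _ (ih ?_)
    obtain ⟨C, hC⟩ := h.bound
    refine IsBigO.of_bound C ?_
    filter_upwards [hC, self_mem_nhdsWithin] with t ht ht0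
    have ht0' : (0 : ℝ) < t := ht0
    simp only [Polynomial.eval_mul, Polynomial.eval_X, norm_mul, pow_succ', Complex.norm_real] at ht
    have : 0 < ‖t‖ := norm_pos_iff.2 ht0'.ne'
    refine le_of_mul_le_mul_left ?_ this
    linarith

namespace HasExpansion

variable {F G : ℝ → ℂ} {φ ψ : PowerSeries ℂ}

theorem isBigO_pow (hF : HasExpansion F φ) {N : ℕ} (h : PowerSeries.X ^ N ∣ φ) :
    F =O[𝓝[>] 0] fun t : ℝ => t ^ N := by
  obtain ⟨P, hP, hFP⟩ := hF N
  have hdvd : PowerSeries.X ^ N ∣ (P : PowerSeries ℂ) := by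
    simpa using dvd_sub h hP
  simpa using hFP.add (isBigO_eval_of_X_pow_dvd hdvd)

theorem isBigO_one (hF : HasExpansion F φ) : F =O[𝓝[>] 0] fun _ : ℝ => (1 : ℝ) := by
  simpa using hF.isBigO_pow (N := 0) (by simp)

theorem ofPolynomial (P : Polynomial ℂ) :
    HasExpansion (fun t => P.eval (t : ℂ)) (P : PowerSeries ℂ) := fun N =>
  ⟨P, by simp, by simpa using isBigO_zero _ _⟩

theorem const (a : ℂ) : HasExpansion (fun _ => a) (PowerSeries.C a) := by
  simpa using ofPolynomial (Polynomial.C a)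

theorem ofReal_pow (k : ℕ) : HasExpansion (fun t => (t : ℂ) ^ k) (PowerSeries.X ^ k) := by
  simpa using ofPolynomial (Polynomial.X ^ k)

theorem congr (hF : HasExpansion F φ) (h : F =ᶠ[𝓝[>] 0] G) : HasExpansion G φ := by
  intro N
  obtain ⟨P, hP, hFP⟩ := hF N
  refine ⟨P, hP, hFP.congr' ?_ EventuallyEq.rfl⟩
  filter_upwards [h] with t ht
  rw [ht]

theorem add (hF : HasExpansion F φ) (hG : HasExpansion G ψ) :
    HasExpansion (fun t => F t + G t) (φ + ψ) := by
  intro N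
  obtain ⟨P, hP, hFP⟩ := hF N
  obtain ⟨Q, hQ, hGQ⟩ := hG N
  refine ⟨P + Q, ?_, (hFP.add hGQ).congr_left fun t => ?_⟩
  · have := dvd_add hP hQ
    rwa [Polynomial.coe_add, add_sub_add_comm]
  · rw [Polynomial.eval_add]; ring

theorem mul (hF : HasExpansion F φ) (hG : HasExpansion G ψ) :
    HasExpansion (fun t => F t * G t) (φ * ψ) := by
  intro N
  obtain ⟨P, hP, hFP⟩ := hF N
  obtain ⟨Q, hQ, hGQ⟩ := hG N
  refine ⟨P * Q, ?_, ?_⟩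
  · have : φ * ψ - ((P * Q : Polynomial ℂ) : PowerSeries ℂ) = φ * (ψ - Q) + (φ - P) * Q := by
      rw [Polynomial.coe_mul]; ring
    rw [this]
    exact dvd_add (hQ.mul_left _) (hP.mul_right _)
  · have h1 := hF.isBigO_one.mul hGQ
    have h2 := hFP.mul (isBigO_eval_one Q)
    simp only [one_mul, mul_one] at h1 h2
    refine (h1.add h2).congr_left fun t => ?_
    rw [Polynomial.eval_mul]; ring

theorem const_mul (a : ℂ) (hF : HasExpansion F φ) :
    HasExpansion (fun t => a * F t) (PowerSeries.C a * φ) := (const a).mul hF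

theorem sub (hF : HasExpansion F φ) (hG : HasExpansion G ψ) :
    HasExpansion (fun t => F t - G t) (φ - ψ) := by
  have := hF.add (hG.const_mul (-1))
  simpa [sub_eq_add_neg] using this

theorem sum {ι : Type*} (s : Finset ι) {F : ι → ℝ → ℂ} {φ : ι → PowerSeries ℂ}
    (h : ∀ i ∈ s, HasExpansion (F i) (φ i)) :
    HasExpansion (fun t => ∑ i ∈ s, F i t) (∑ i ∈ s, φ i) := by
  induction s using Finset.induction_on with
  | empty => simpa using const 0
  | insert a s ha ih =>
    simp only [Finset.sum_insert ha]
    exact (h a (Finset.mem_insert_self _ _)).add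
      (ih fun i hi => h i (Finset.mem_insert_of_mem hi))

theorem prod {ι : Type*} (s : Finset ι) {F : ι → ℝ → ℂ} {φ : ι → PowerSeries ℂ}
    (h : ∀ i ∈ s, HasExpansion (F i) (φ i)) :
    HasExpansion (fun t => ∏ i ∈ s, F i t) (∏ i ∈ s, φ i) := by
  induction s using Finset.induction_on with
  | empty => simpa using const 1
  | insert a s ha ih =>
    simp only [Finset.prod_insert ha]
    exact (h a (Finset.mem_insert_self _ _)).mul
      (ih fun i hi => h i (Finset.mem_insert_of_mem hi))

theorem unique (hF : HasExpansion F φ) (hG : HasExpansion F ψ) : φ = ψ := by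
  ext m
  obtain ⟨P, hP, hFP⟩ := hF (m + 1)
  obtain ⟨Q, hQ, hFQ⟩ := hG (m + 1)
  have hPQ : Polynomial.X ^ (m + 1) ∣ P - Q := by
    refine X_pow_dvd_of_isBigO_eval ((hFQ.sub hFP).congr_left fun t => ?_)
    rw [Polynomial.eval_sub]; ring
  have h1 := PowerSeries.X_pow_dvd_iff.1 hP m (Nat.lt_succ_self m)
  have h2 := PowerSeries.X_pow_dvd_iff.1 hQ m (Nat.lt_succ_self m)
  have h3 := Polynomial.X_pow_dvd_iff.1 hPQ m (Nat.lt_succ_self m)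
  simp only [map_sub, Polynomial.coeff_coe, Polynomial.coeff_sub] at h1 h2 h3
  linear_combination h1 - h2 + h3

theorem X_pow_dvd_sub_trunc (φ : PowerSeries ℂ) (N : ℕ) :
    PowerSeries.X ^ N ∣ φ - (PowerSeries.trunc N φ : PowerSeries ℂ) := by
  rw [PowerSeries.X_pow_dvd_iff]
  intro m hm
  simp [PowerSeries.coeff_trunc, hm]

/-- The remainder bound of the exponential series, which gives expansions uniformly in the
exponent. -/
theorem norm_exp_sub_trunc_le (w : ℂ) {R t : ℝ} (hw : ‖w‖ ≤ R) (ht : 0 ≤ t) (ht1 : t ≤ 1)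
    (N : ℕ) :
    ‖Complex.exp (w * t) - ∑ k ∈ Finset.range N, (w ^ k / k.factorial) * (t : ℂ) ^ k‖ ≤
      R ^ N * Real.exp R * t ^ N := by
  have h := Complex.norm_exp_sub_sum_le_norm_mul_exp (w * t) N
  have hsum : ∑ k ∈ Finset.range N, (w ^ k / k.factorial) * (t : ℂ) ^ k =
      ∑ k ∈ Finset.range N, (w * t) ^ k / k.factorial :=
    Finset.sum_congr rfl fun k _ => by rw [mul_pow]; ring
  rw [hsum]
  refine h.trans ?_
  have hnorm : ‖w * (t : ℂ)‖ = ‖w‖ * t := by simp [abs_of_nonneg ht]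
  rw [hnorm, mul_pow, mul_right_comm]
  have hR : 0 ≤ R := (norm_nonneg w).trans hw
  gcongr
  nlinarith [norm_nonneg w]

theorem exp (w : ℂ) :
    HasExpansion (fun t => Complex.exp (w * t)) (PowerSeries.rescale w (PowerSeries.exp ℂ)) := by
  intro N
  refine ⟨_, X_pow_dvd_sub_trunc _ N, IsBigO.of_bound (‖w‖ ^ N * Real.exp ‖w‖) ?_⟩
  have h1 : ∀ᶠ t : ℝ in 𝓝[>] 0, t ≤ 1 :=
    (eventually_le_nhds one_pos).filter_mono nhdsWithin_le_nhds
  filter_upwards [self_mem_nhdsWithin, h1] with t ht ht1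
  have ht0 : (0 : ℝ) ≤ t := le_of_lt ht
  have := norm_exp_sub_trunc_le w le_rfl ht0 ht1 N
  rw [PowerSeries.trunc_apply, Polynomial.eval_finsetSum]
  simp only [Polynomial.eval_monomial, PowerSeries.coeff_rescale, PowerSeries.coeff_exp,
    Nat.Ico_zero_eq_range]
  simpa [div_eq_mul_inv, abs_of_nonneg ht0] using this

/-- Division by a function with a simple zero at the origin. -/
theorem of_mul {K : ℝ → ℂ} {κ : PowerSeries ℂ} {γ : PowerSeries ℂ} (hG : HasExpansion G γ)
    (hK : HasExpansion K κ) (hmul : (fun t => F t * G t) =ᶠ[𝓝[>] 0] K) (hφ : φ * γ = κ)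
    (hγ : PowerSeries.X ∣ γ) (hinv : (fun t : ℝ => t) =O[𝓝[>] 0] G) : HasExpansion F φ := by
  intro N
  refine ⟨_, X_pow_dvd_sub_trunc φ N, ?_⟩
  set P := PowerSeries.trunc N φ
  have hdvd : PowerSeries.X ^ (N + 1) ∣ κ - (P : PowerSeries ℂ) * γ := by
    rw [← hφ, ← sub_mul, pow_succ]
    exact mul_dvd_mul (X_pow_dvd_sub_trunc φ N) hγ
  have hbig := (hK.sub ((ofPolynomial P).mul hG)).isBigO_pow hdvd
  have hbig' : (fun t : ℝ => (F t - P.eval (t : ℂ)) * G t) =O[𝓝[>] 0] fun t : ℝ => t ^ (N + 1) := by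
    refine hbig.congr' ?_ EventuallyEq.rfl
    filter_upwards [hmul] with t ht
    rw [← ht]; ring
  obtain ⟨C, hC⟩ := hbig'.bound
  obtain ⟨D, hD⟩ := hinv.bound
  refine IsBigO.of_bound (D * C) ?_
  filter_upwards [hC, hD, self_mem_nhdsWithin] with t h1 h2 ht
  have ht0 : (0 : ℝ) < ‖t‖ := norm_pos_iff.2 (ne_of_gt ht)
  rw [norm_mul, pow_succ, norm_mul] at h1
  have hD0 : 0 < D * ‖G t‖ := ht0.trans_le h2
  have hGpos : 0 < ‖G t‖ := by
    rcases (norm_nonneg (G t)).eq_or_lt with h | h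
    · rw [← h, mul_zero] at hD0; exact absurd hD0 (lt_irrefl _)
    · exact h
  have hDpos : 0 < D := by
    by_contra h; nlinarith
  have h3 : ‖F t - P.eval (t : ℂ)‖ * ‖t‖ ≤ ‖F t - P.eval (t : ℂ)‖ * (D * ‖G t‖) :=
    mul_le_mul_of_nonneg_left h2 (norm_nonneg _)
  have h4 : D * (‖F t - P.eval (t : ℂ)‖ * ‖G t‖) ≤ D * (C * (‖t ^ N‖ * ‖t‖)) :=
    mul_le_mul_of_nonneg_left h1 hDpos.le
  refine le_of_mul_le_mul_right ?_ ht0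
  linarith

end HasExpansion

/-- The Hirzebruch power series `χ_q`. -/
noncomputable def chiSeries (q : ℂ) : PowerSeries ℂ := PowerSeries.mk (chiCoeff q)

theorem chiSeries_mul_exp_sub_one (q : ℂ) :
    chiSeries q * (PowerSeries.exp ℂ - 1) =
      PowerSeries.C q * PowerSeries.X * (PowerSeries.exp ℂ - 1) + PowerSeries.X := by
  have h : chiSeries q = PowerSeries.C q * bernoulli'PowerSeries ℂ +
      PowerSeries.C (1 - q) * bernoulliPowerSeries ℂ := by
    ext j
    simp only [chiSeries, PowerSeries.coeff_mk, chiCoeff, toddCoeff, map_add,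
      PowerSeries.coeff_C_mul, bernoulli'PowerSeries, bernoulliPowerSeries, bernoulli]
    simp only [map_div₀, map_mul, map_pow, map_neg, map_one, map_natCast, eq_ratCast]
    ring
  have h1 := bernoulli'PowerSeries_mul_exp_sub_one ℂ
  have h2 := bernoulliPowerSeries_mul_exp_sub_one ℂ
  rw [h, add_mul, mul_assoc, h1, mul_assoc, h2, map_sub, map_one]
  ring

theorem constantCoeff_chiSeries (q : ℂ) : PowerSeries.constantCoeff (chiSeries q) = 1 := by
  simp [chiSeries, chiCoeff, toddCoeff]

theorem hasExpansion_chiSeries (q : ℂ) {c : ℝ} (hc : c ≠ 0) :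
    HasExpansion (fun t => t * (q + 1 / (Complex.exp (c * t) - 1)))
      (PowerSeries.C (1 / (c : ℂ)) * PowerSeries.rescale (c : ℂ) (chiSeries q)) := by
  have hc' : (c : ℂ) ≠ 0 := by exact_mod_cast hc
  have hG : HasExpansion (fun t => Complex.exp (c * t) - 1)
      (PowerSeries.rescale (c : ℂ) (PowerSeries.exp ℂ) - 1) := by
    simpa using (HasExpansion.exp c).sub (HasExpansion.const 1)
  have hX : HasExpansion (fun t => (t : ℂ)) PowerSeries.X := by
    simpa using HasExpansion.ofReal_pow 1
  have hK := ((hX.const_mul q).mul hG).add hX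
  have hne : ∀ t : ℝ, 0 < t → Complex.exp (c * t) - 1 ≠ 0 := by
    intro t ht h
    have : Real.exp (c * t) = 1 := by
      have := sub_eq_zero.1 h
      exact_mod_cast this
    rw [Real.exp_eq_one_iff] at this
    exact mul_ne_zero hc ht.ne' this
  refine HasExpansion.of_mul hG hK ?_ ?_ ?_ ?_
  · filter_upwards [self_mem_nhdsWithin] with t ht
    have := hne t ht
    rw [mul_assoc, add_mul, one_div, inv_mul_cancel₀ this]
    ring
  · have h := congrArg (PowerSeries.rescale (c : ℂ)) (chiSeries_mul_exp_sub_one q)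
    simp only [map_mul, map_sub, map_add, map_one, PowerSeries.rescale_X] at h
    have hCq : PowerSeries.rescale (c : ℂ) (PowerSeries.C q) = PowerSeries.C q := by
      ext m; simp only [PowerSeries.coeff_rescale, PowerSeries.coeff_C]; split_ifs with hm <;> simp [hm]
    rw [hCq] at h
    rw [mul_assoc, h]
    have hone : PowerSeries.C (1 / (c : ℂ)) * PowerSeries.C (c : ℂ) = 1 := by
      rw [← map_mul, one_div, inv_mul_cancel₀ hc', map_one]
    linear_combination (PowerSeries.C q * PowerSeries.X *
      (PowerSeries.rescale (c : ℂ) (PowerSeries.exp ℂ) - 1) + PowerSeries.X) * hone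
  · rw [PowerSeries.X_dvd_iff]
    rw [map_sub, ← PowerSeries.coeff_zero_eq_constantCoeff_apply, PowerSeries.coeff_rescale]
    simp
  · have hderiv : HasDerivAt (fun t : ℝ => Complex.exp (c * t) - 1) (c : ℂ) 0 := by
      have h1 : HasDerivAt (fun t : ℝ => (c : ℂ) * (t : ℂ)) (c : ℂ) 0 := by
        simpa using (Complex.ofRealCLM.hasDerivAt (x := (0 : ℝ))).const_mul (c : ℂ)
      simpa using h1.cexp.sub_const 1
    have hto : Tendsto (fun t : ℝ => (t, (0 : ℝ))) (𝓝[>] 0) (𝓝 0 ×ˢ pure 0) :=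
      (tendsto_id.mono_left nhdsWithin_le_nhds).prodMk (tendsto_pure.2 (Eventually.of_forall fun _ => rfl))
    simpa [Function.comp_def] using ((hderiv.isTheta_sub hc').isBigO_symm).comp_tendsto hto

end AsymptoticExpansion

section ConeTransform

/-- The weight of a facet inequality with slack `y`: `1` inside, `q` on the boundary, `0`
outside. -/
noncomputable def facetWeight (q : ℂ) (y : ℝ) : ℂ := if 0 < y then 1 else if y = 0 then q else 0

/-- The facet weight, polarized according to the sign of `c`. -/
noncomputable def polarWeight (q : ℂ) (c y : ℝ) : ℂ :=
  if 0 < c then facetWeight q y else facetWeight q y - 1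

theorem hasSum_polarWeight_mul_exp (q : ℂ) {c : ℝ} (hc : c ≠ 0) :
    HasSum (fun m : ℤ => polarWeight q c m * Complex.exp (-(c * m : ℝ)))
      (q + 1 / (Complex.exp c - 1)) := by
  have hgeom : ∀ a : ℝ, 0 < a →
      HasSum (fun k : ℕ => Complex.exp (-(a * k : ℝ))) (1 - Complex.exp (-a : ℝ))⁻¹ := by
    intro a ha
    have hlt : ‖Complex.exp (-a : ℝ)‖ < 1 := by
      rw [Complex.norm_exp_ofReal, Real.exp_lt_one_iff]; linarith
    refine (hasSum_geometric_of_norm_lt_one hlt).congr_fun fun k => ?_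
    rw [← Complex.exp_nat_mul]
    congr 1; push_cast; ring
  have hne : Complex.exp c ≠ 1 := by
    intro h
    have : Real.exp c = 1 := by exact_mod_cast h
    exact hc (Real.exp_eq_one_iff c |>.1 this)
  have hne1 : Complex.exp c - 1 ≠ 0 := sub_ne_zero.2 hne
  have hpos : ∀ k : ℕ, ¬ (0 : ℝ) < ((-(k + 1) : ℤ) : ℝ) := fun k => by
    push_cast; have : (0 : ℝ) ≤ k := k.cast_nonneg
    linarith
  have hnz : ∀ k : ℕ, ((-(k + 1) : ℤ) : ℝ) ≠ 0 := fun k => by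
    push_cast; have : (0 : ℝ) ≤ k := k.cast_nonneg
    linarith
  rcases hc.lt_or_gt with hneg | hcpos
  · have h1 : HasSum (fun k : ℕ => polarWeight q c ((k : ℤ) : ℝ) *
        Complex.exp (-(c * ((k : ℤ) : ℝ) : ℝ))) (q - 1) := by
      have := hasSum_ite_eq (0 : ℕ) (q - 1)
      convert this using 1
      funext k
      rcases Nat.eq_zero_or_pos k with rfl | hk
      · simp [polarWeight, facetWeight, hneg.not_gt]
      · have hk' : (0 : ℝ) < ((k : ℤ) : ℝ) := by exact_mod_cast hk
        simp only [polarWeight, facetWeight, if_neg hneg.not_gt, if_pos hk', sub_self, zero_mul,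
          if_neg hk.ne']
    have h2 : HasSum (fun k : ℕ => polarWeight q c ((-(k + 1) : ℤ) : ℝ) *
        Complex.exp (-(c * ((-(k + 1) : ℤ) : ℝ) : ℝ)))
        (-Complex.exp c * (1 - Complex.exp (-(-c) : ℝ))⁻¹) := by
      refine ((hgeom (-c) (by linarith)).mul_left (-Complex.exp c)).congr_fun fun k => ?_
      simp only [polarWeight, facetWeight, if_neg hneg.not_gt, if_neg (hpos k), if_neg (hnz k)]
      rw [neg_mul, ← Complex.exp_add, zero_sub, neg_one_mul]
      congr 2; push_cast; ring
    convert HasSum.of_nat_of_neg_add_one (f := fun m : ℤ =>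
      polarWeight q c m * Complex.exp (-(c * m : ℝ))) h1 h2 using 1
    have : 1 - Complex.exp c ≠ 0 := sub_ne_zero.2 hne.symm
    rw [neg_neg]
    field_simp
    ring
  · have h1 : HasSum (fun k : ℕ => polarWeight q c ((k : ℤ) : ℝ) *
        Complex.exp (-(c * ((k : ℤ) : ℝ) : ℝ))) ((1 - Complex.exp (-c : ℝ))⁻¹ + (q - 1)) := by
      convert (hgeom c hcpos).add (hasSum_ite_eq (0 : ℕ) (q - 1)) using 1
      funext k
      rcases Nat.eq_zero_or_pos k with rfl | hk
      · simp [polarWeight, facetWeight, hcpos]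
      · have hk' : (0 : ℝ) < k := by exact_mod_cast hk
        simp only [polarWeight, facetWeight, if_pos hcpos, if_pos hk', one_mul, if_neg hk.ne',
          add_zero, Int.cast_natCast]
    have h2 : HasSum (fun k : ℕ => polarWeight q c ((-(k + 1) : ℤ) : ℝ) *
        Complex.exp (-(c * ((-(k + 1) : ℤ) : ℝ) : ℝ))) 0 := by
      convert hasSum_zero using 1
      funext k
      simp only [polarWeight, facetWeight, if_pos hcpos, if_neg (hpos k), if_neg (hnz k), zero_mul]
    convert HasSum.of_nat_of_neg_add_one (f := fun m : ℤ =>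
      polarWeight q c m * Complex.exp (-(c * m : ℝ))) h1 h2 using 1
    have hexp : Complex.exp (-c : ℝ) = (Complex.exp c)⁻¹ := by
      push_cast; rw [Complex.exp_neg]
    have hc0 := Complex.exp_ne_zero (c : ℂ)
    have : 1 - (Complex.exp c)⁻¹ ≠ 0 := by
      rw [sub_ne_zero]; intro h; exact hne (inv_eq_one.1 h.symm)
    rw [hexp]
    have hinv : (1 - (Complex.exp c)⁻¹)⁻¹ = Complex.exp c / (Complex.exp c - 1) := by
      rw [inv_eq_iff_eq_inv, inv_div, sub_div, div_self hc0, one_div]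
    rw [hinv]
    field_simp
    ring

theorem integral_polarWeight_mul_exp {c : ℝ} (hc : c ≠ 0) :
    Integrable (fun y : ℝ => polarWeight 1 c y * Complex.exp (-(c * y : ℝ))) ∧
      ∫ y : ℝ, polarWeight 1 c y * Complex.exp (-(c * y : ℝ)) = 1 / (c : ℂ) := by
  have hexp : ∀ y : ℝ, Complex.exp (-(c * y : ℝ)) = Complex.exp ((-c : ℂ) * y) := by
    intro y; congr 1; push_cast; ring
  have hwt : ∀ y : ℝ, facetWeight 1 y = if 0 ≤ y then 1 else 0 := by
    intro y; rcases lt_trichotomy y 0 with h | rfl | h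
    · simp [facetWeight, h.not_gt, h.ne, h.not_ge]
    · simp [facetWeight]
    · simp [facetWeight, h, h.le]
  rcases hc.lt_or_gt with hneg | hpos
  · have hfun : (fun y : ℝ => polarWeight 1 c y * Complex.exp (-(c * y : ℝ))) =
        Set.indicator (Set.Iio 0) fun y : ℝ => -Complex.exp ((-c : ℂ) * y) := by
      funext y
      rw [hexp, polarWeight, if_neg hneg.not_gt, hwt]
      by_cases hy : y < 0
      · simp [hy, hy.not_ge]
      · simp [hy, not_lt.1 hy]
    have hre : 0 < (-c : ℂ).re := by simpa using hneg
    have hint := (integrableOn_exp_mul_complex_Iic hre 0).mono_set Set.Iio_subset_Iic_self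
    rw [hfun]
    refine ⟨(integrable_indicator_iff measurableSet_Iio).2 hint.neg, ?_⟩
    rw [integral_indicator measurableSet_Iio, ← integral_Iic_eq_integral_Iio, integral_neg,
      integral_exp_mul_complex_Iic hre]
    simp [div_neg]
  · have hfun : (fun y : ℝ => polarWeight 1 c y * Complex.exp (-(c * y : ℝ))) =
        Set.indicator (Set.Ici 0) fun y : ℝ => Complex.exp ((-c : ℂ) * y) := by
      funext y
      rw [hexp, polarWeight, if_pos hpos, hwt]
      by_cases hy : 0 ≤ y
      · simp [hy]
      · simp [hy]
    have hre : (-c : ℂ).re < 0 := by simpa using hpos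
    have hint := (integrableOn_Ici_iff_integrableOn_Ioi).2 (integrableOn_exp_mul_complex_Ioi hre 0)
    rw [hfun]
    refine ⟨(integrable_indicator_iff measurableSet_Ici).2 hint, ?_⟩
    rw [integral_indicator measurableSet_Ici, integral_Ici_eq_integral_Ioi,
      integral_exp_mul_complex_Ioi hre]
    simp [neg_div, div_neg]

theorem hasSum_fin_prod {n : ℕ} {f : Fin n → ℤ → ℂ} {a : Fin n → ℂ}
    (h : ∀ i, HasSum (f i) (a i)) :
    HasSum (fun s : Fin n → ℤ => ∏ i, f i (s i)) (∏ i, a i) := by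
  induction n with
  | zero => simp [hasSum_unique]
  | succ n ih =>
    have htail := ih fun i => h i.succ
    have hn0 : Summable fun k => ‖f 0 k‖ := (h 0).summable.norm
    have hn1 : Summable fun s : Fin n → ℤ => ‖∏ i : Fin n, f i.succ (s i)‖ :=
      htail.summable.norm
    have hsum := summable_mul_of_summable_norm hn0 hn1
    have hmul := HasSum.mul (h 0) htail hsum
    have hfun : (fun s : Fin (n + 1) → ℤ => ∏ i, f i (s i)) ∘ (Fin.consEquiv fun _ => ℤ) =
        fun x => f 0 x.1 * ∏ i : Fin n, f i.succ (x.2 i) := by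
      funext x
      simp [Fin.prod_univ_succ, Fin.consEquiv]
    have hiff := (Fin.consEquiv fun _ : Fin (n + 1) => ℤ).hasSum_iff
      (f := fun s => ∏ i, f i (s i)) (a := ∏ i, a i)
    rw [← hiff, hfun, Fin.prod_univ_succ]
    exact hmul

theorem hasSum_prod_mulVec {n : ℕ} {A B : Matrix (Fin n) (Fin n) ℤ} (hAB : A * B = 1)
    (m : Fin n → ℤ) {f : Fin n → ℤ → ℂ} {a : Fin n → ℂ} (h : ∀ k, HasSum (f k) (a k)) :
    HasSum (fun x : Fin n → ℤ => ∏ k, f k (A.mulVec x k + m k)) (∏ k, a k) := by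
  have hBA : B * A = 1 := mul_eq_one_comm.1 hAB
  let e : (Fin n → ℤ) ≃ (Fin n → ℤ) :=
    { toFun := fun x => A.mulVec x + m
      invFun := fun s => B.mulVec (s - m)
      left_inv := fun x => by simp [hBA]
      right_inv := fun s => by simp [hAB] }
  have := e.hasSum_iff (f := fun s => ∏ k, f k (s k)) (a := ∏ k, a k)
  exact this.2 (hasSum_fin_prod h)

theorem integral_prod_mulVec {n : ℕ} {A B : Matrix (Fin n) (Fin n) ℤ} (hAB : A * B = 1)
    (m : Fin n → ℝ) {f : Fin n → ℝ → ℂ} (h : ∀ k, Integrable (f k)) :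
    Integrable (fun x : Fin n → ℝ => ∏ k, f k (intPair (A k) x + m k)) ∧
      ∫ x : Fin n → ℝ, ∏ k, f k (intPair (A k) x + m k) = ∏ k, ∫ y, f k y := by
  let M : Matrix (Fin n) (Fin n) ℝ := A.map (Int.cast : ℤ → ℝ)
  have hdet : M.det = (A.det : ℝ) := by
    simpa [M] using (RingHom.map_det (Int.castRingHom ℝ) A).symm
  have hunit : IsUnit A.det := IsUnit.of_mul_eq_one (B.det) (by rw [← Matrix.det_mul, hAB, Matrix.det_one])
  have habs : |M.det| = 1 := by
    rw [hdet]; rcases Int.isUnit_iff.1 hunit with h | h <;> simp [h]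
  have hne : M.det ≠ 0 := by intro h; rw [h, abs_zero] at habs; exact zero_ne_one habs
  have hcont : Continuous (Matrix.toLin' M) := LinearMap.continuous_of_finiteDimensional _
  have hlin : MeasurePreserving (Matrix.toLin' M) volume volume :=
    ⟨hcont.measurable, by
      rw [Real.map_matrix_volume_pi_eq_smul_volume_pi hne, abs_inv, habs]; simp⟩
  have hadd : MeasurePreserving (fun s : Fin n → ℝ => s + m) volume volume :=
    measurePreserving_add_right volume m
  have hpres : MeasurePreserving (fun x : Fin n → ℝ => Matrix.toLin' M x + m) volume volume :=
    hadd.comp hlin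
  have hfun : (fun x : Fin n → ℝ => ∏ k, f k (intPair (A k) x + m k)) =
      (fun s : Fin n → ℝ => ∏ k, f k (s k)) ∘ fun x => Matrix.toLin' M x + m := by
    funext x
    simp [intPair, M, Matrix.mulVec, dotProduct]
  have hint : Integrable (fun s : Fin n → ℝ => ∏ k, f k (s k)) := Integrable.fintype_prod h
  have hemb : MeasurableEmbedding (fun x : Fin n → ℝ => Matrix.toLin' M x + m) := by
    have hMinv : IsUnit M.det := isUnit_iff_ne_zero.2 hne
    let e := Matrix.toLinearEquiv' M (M.invertibleOfIsUnitDet hMinv)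
    exact (Homeomorph.addRight m).measurableEmbedding.comp
      e.toContinuousLinearEquiv.toHomeomorph.measurableEmbedding
  rw [hfun]
  exact ⟨hpres.integrable_comp_of_integrable hint,
    (hpres.integral_comp hemb _).trans (integral_fintype_prod_volume_eq_prod f)⟩

end ConeTransform

section Geometry

variable {n d : ℕ}

/-- The linear map `x ↦ (⟨uᵢ, x⟩)ᵢ`. -/
noncomputable def facetMap (u : Fin d → Fin n → ℤ) : (Fin n → ℝ) →ₗ[ℝ] (Fin d → ℝ) :=
  Matrix.mulVecLin (Matrix.of fun i j => (u i j : ℝ))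

theorem facetMap_apply (u : Fin d → Fin n → ℤ) (x : Fin n → ℝ) (i : Fin d) :
    facetMap u x i = intPair (u i) x := rfl

theorem continuous_facetMap (u : Fin d → Fin n → ℤ) : Continuous (facetMap u) :=
  LinearMap.continuous_of_finiteDimensional _

/-- The polyhedron `{x : ⟨uᵢ, x⟩ + νᵢ ≥ 0}`. -/
def polyhedron (u : Fin d → Fin n → ℤ) (ν : Fin d → ℝ) : Set (Fin n → ℝ) :=
  {x | ∀ i, 0 ≤ intPair (u i) x + ν i}

theorem mem_polyhedron {u : Fin d → Fin n → ℤ} {ν : Fin d → ℝ} {x : Fin n → ℝ} :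
    x ∈ polyhedron u ν ↔ ∀ i, 0 ≤ facetMap u x i + ν i := Iff.rfl

theorem isClosed_polyhedron (u : Fin d → Fin n → ℤ) (ν : Fin d → ℝ) :
    IsClosed (polyhedron u ν) := by
  have : polyhedron u ν = ⋂ i, {x | 0 ≤ facetMap u x i + ν i} := by
    ext x; simp [mem_polyhedron]
  rw [this]
  exact isClosed_iInter fun i => isClosed_le continuous_const
    (((continuous_apply i).comp (continuous_facetMap u)).add continuous_const)

theorem exists_forall_pos_slack {u : Fin d → Fin n → ℤ} {ν : Fin d → ℝ} (hu : ∀ i, u i ≠ 0)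
    (hint : (interior (polyhedron u ν)).Nonempty) :
    ∃ x, ∀ i, 0 < facetMap u x i + ν i := by
  obtain ⟨x, hx⟩ := hint
  refine ⟨x, fun i => ?_⟩
  let w : Fin n → ℝ := fun j => (u i j : ℝ)
  have hw : 0 < facetMap u w i := by
    have hexp : facetMap u w i = ∑ j, (u i j : ℝ) * u i j := rfl
    rw [hexp]
    obtain ⟨j, hj⟩ := Function.ne_iff.1 (hu i)
    have hj' : (u i j : ℝ) ≠ 0 := by exact_mod_cast hj
    exact Finset.sum_pos' (fun k _ => mul_self_nonneg _)
      ⟨j, Finset.mem_univ j, mul_self_pos.2 hj'⟩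
  have hcont : Filter.Tendsto (fun s : ℝ => x - s • w) (nhdsWithin 0 (Set.Ioi 0)) (nhds x) := by
    have : Continuous fun s : ℝ => x - s • w := by fun_prop
    simpa using (this.tendsto 0).mono_left nhdsWithin_le_nhds
  have hev : ∀ᶠ s in nhdsWithin (0 : ℝ) (Set.Ioi 0), x - s • w ∈ polyhedron u ν :=
    hcont.eventually (mem_interior_iff_mem_nhds.1 hx)
  obtain ⟨s, hs, hs0⟩ := (hev.and self_mem_nhdsWithin).exists
  have h := mem_polyhedron.1 hs i
  rw [map_sub, map_smul, Pi.sub_apply, Pi.smul_apply, smul_eq_mul] at h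
  have : 0 < s * facetMap u w i := mul_pos hs0 hw
  linarith

theorem exists_facetMap_pos {u : Fin d → Fin n → ℤ} {ν : Fin d → ℝ}
    (hcomp : IsCompact (polyhedron u ν)) (hne : (polyhedron u ν).Nonempty)
    (z : Fin n → ℝ) (hz : z ≠ 0) : ∃ i, 0 < facetMap u z i := by
  by_contra! hle
  obtain ⟨x, hx⟩ := hne
  obtain ⟨R, hR⟩ := hcomp.isBounded.exists_norm_le
  have hz0 : 0 < ‖z‖ := norm_pos_iff.2 hz
  have hR0 : 0 ≤ R := (norm_nonneg x).trans (hR x hx)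
  let s : ℝ := (R + ‖x‖ + 1) / ‖z‖
  have hs : 0 ≤ s := by positivity
  have hmem : x - s • z ∈ polyhedron u ν := mem_polyhedron.2 fun i => by
    rw [map_sub, map_smul, Pi.sub_apply, Pi.smul_apply, smul_eq_mul]
    have h1 := mem_polyhedron.1 hx i
    have h2 := mul_nonneg_of_nonpos_of_nonpos (neg_nonpos.2 hs) (hle i)
    linarith
  have h1 := hR _ hmem
  have h2 : ‖s • z‖ ≤ ‖x‖ + ‖x - s • z‖ := by
    have := norm_sub_le x (x - s • z)
    rwa [sub_sub_cancel] at this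
  rw [norm_smul, Real.norm_of_nonneg hs, div_mul_cancel₀ _ hz0.ne'] at h2
  linarith

theorem exists_eventually_norm_le {u : Fin d → Fin n → ℤ} {μ : Fin d → ℝ}
    (hcomp : IsCompact (polyhedron u μ)) {x₀ : Fin n → ℝ}
    (hx₀ : ∀ i, 0 < facetMap u x₀ i + μ i) :
    ∃ R : ℝ, ∀ᶠ ν in nhds μ, ∀ x ∈ polyhedron u ν, ‖x‖ ≤ R := by
  obtain ⟨R, hR⟩ := hcomp.isBounded.exists_norm_le
  refine ⟨2 * R + ‖x₀‖, ?_⟩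
  have hev : ∀ᶠ ν in nhds μ, ∀ i, ν i < facetMap u x₀ i + μ i + μ i :=
    Filter.eventually_all.2 fun i =>
      (continuous_apply i).continuousAt.eventually (gt_mem_nhds (by simpa using hx₀ i))
  filter_upwards [hev] with ν hν x hx
  have hmem : (2⁻¹ : ℝ) • (x + x₀) ∈ polyhedron u μ := mem_polyhedron.2 fun i => by
    rw [map_smul, map_add, Pi.smul_apply, Pi.add_apply, smul_eq_mul]
    have h1 := mem_polyhedron.1 hx i
    have h2 := hν i
    linarith
  have h1 := hR _ hmem
  rw [norm_smul, norm_inv, Real.norm_two] at h1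
  have h2 : ‖x‖ ≤ ‖x + x₀‖ + ‖x₀‖ := by
    have := norm_sub_le (x + x₀) x₀
    rwa [add_sub_cancel_right] at this
  linarith

/-- The combinatorial data of a smooth lattice vertex: the facets through it, the basis dual to
their normals, and their (integral) constants. -/
structure VertexFrame (u : Fin d → Fin n → ℤ) (μ : Fin d → ℝ) (v : Fin n → ℝ) where
  facet : Fin n → Fin d
  facet_injective : Function.Injective facet
  tight_iff : ∀ i, facetMap u v i + μ i = 0 ↔ i ∈ Set.range facet
  dual : Matrix (Fin n) (Fin n) ℤ
  mul_dual : (Matrix.of fun k => u (facet k)) * dual = 1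
  level : Fin n → ℤ
  level_eq : ∀ k, μ (facet k) = level k

theorem nonempty_vertexFrame {u : Fin d → Fin n → ℤ} {μ : Fin d → ℝ} {v : Fin n → ℝ}
    (hvint : ∃ g : Fin n → ℤ, v = fun j => (g j : ℝ))
    (hcard : (Finset.univ.filter fun i => intPair (u i) v + μ i = 0).card = n)
    (hspan : Submodule.span ℤ {w : Fin n → ℤ | ∃ i, intPair (u i) v + μ i = 0 ∧ w = u i} = ⊤) :
    Nonempty (VertexFrame u μ v) := by
  obtain ⟨g, rfl⟩ := hvint
  let σ := (Finset.univ.filter fun i =>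
    intPair (u i) (fun j => (g j : ℝ)) + μ i = 0).orderEmbOfFin hcard
  have hσ : ∀ i, intPair (u i) (fun j => (g j : ℝ)) + μ i = 0 ↔ i ∈ Set.range σ := by
    intro i; simp [σ]
  have hset : {w : Fin n → ℤ | ∃ i, intPair (u i) (fun j => (g j : ℝ)) + μ i = 0 ∧ w = u i} =
      Set.range fun k => u (σ k) := by
    ext w
    constructor
    · rintro ⟨i, hi, rfl⟩
      obtain ⟨k, rfl⟩ := (hσ i).1 hi
      exact ⟨k, rfl⟩
    · rintro ⟨k, rfl⟩
      exact ⟨σ k, (hσ _).2 ⟨k, rfl⟩, rfl⟩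
  rw [hset] at hspan
  have hrep : ∀ j : Fin n, ∃ c : Fin n → ℤ, ∑ k, c k • u (σ k) = Pi.single j 1 := fun j =>
    Submodule.mem_span_range_iff_exists_fun ℤ |>.1 (hspan ▸ Submodule.mem_top)
  choose B hB using hrep
  have hBA : (Matrix.of B) * (Matrix.of fun k => u (σ k)) = 1 := by
    ext j l
    have := congrFun (hB j) l
    simp only [Finset.sum_apply, Pi.smul_apply, smul_eq_mul] at this
    rw [Matrix.mul_apply, Matrix.one_apply]
    simp only [Matrix.of_apply]
    rw [this, Pi.single_apply]
    simp [eq_comm]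
  refine ⟨⟨σ, σ.injective, hσ, Matrix.of B, mul_eq_one_comm.1 hBA,
    fun k => -∑ j, u (σ k) j * g j, fun k => ?_⟩⟩
  have := (hσ (σ k)).2 ⟨k, rfl⟩
  rw [intPair] at this
  push_cast
  linarith

namespace VertexFrame

variable {u : Fin d → Fin n → ℤ} {μ : Fin d → ℝ} {v : Fin n → ℝ} (F : VertexFrame u μ v)

/-- The edge direction dual to the `k`-th facet normal at the vertex. -/
def dualVec (k : Fin n) : Fin n → ℝ := fun j => (F.dual j k : ℝ)

theorem dual_mul : F.dual * (Matrix.of fun k => u (F.facet k)) = 1 :=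
  mul_eq_one_comm.1 F.mul_dual

theorem facetMap_dualVec (k l : Fin n) :
    facetMap u (F.dualVec k) (F.facet l) = if l = k then 1 else 0 := by
  have h := congrFun (congrFun F.mul_dual l) k
  rw [Matrix.mul_apply, Matrix.one_apply] at h
  have h' : ((∑ j, u (F.facet l) j * F.dual j k : ℤ) : ℝ) = ((if l = k then 1 else 0 : ℤ) : ℝ) :=
    congrArg _ h
  push_cast at h'
  exact h'

theorem eq_sum_dualVec (x : Fin n → ℝ) :
    x = ∑ k, facetMap u x (F.facet k) • F.dualVec k := by
  ext j
  have h := fun l => congrFun (congrFun F.dual_mul j) l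
  simp only [Matrix.mul_apply, Matrix.one_apply, Matrix.of_apply] at h
  have h' : ∀ l, (∑ k, (F.dual j k : ℝ) * u (F.facet k) l) = if j = l then 1 else 0 := by
    intro l
    have := congrArg (Int.cast : ℤ → ℝ) (h l)
    push_cast at this
    exact this
  rw [Finset.sum_apply]
  simp only [Pi.smul_apply, smul_eq_mul, facetMap_apply, intPair, dualVec, Finset.sum_mul]
  rw [Finset.sum_comm]
  have : ∀ l, ∑ k, (u (F.facet k) l : ℝ) * x l * F.dual j k = (if j = l then 1 else 0) * x l := by
    intro l
    rw [← h' l, Finset.sum_mul]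
    exact Finset.sum_congr rfl fun k _ => by ring
  simp [this]

theorem apply_eq_sum (ζ : (Fin n → ℝ) →ₗ[ℝ] ℝ) (x : Fin n → ℝ) :
    ζ x = ∑ k, facetMap u x (F.facet k) * ζ (F.dualVec k) := by
  conv_lhs => rw [F.eq_sum_dualVec x]
  simp

/-- The perturbed vertex, where the facet constants are `ν`. -/
noncomputable def point (ν : Fin d → ℝ) : Fin n → ℝ := -∑ k, ν (F.facet k) • F.dualVec k

theorem eq_point {ν : Fin d → ℝ} {x : Fin n → ℝ}
    (hx : ∀ k, facetMap u x (F.facet k) + ν (F.facet k) = 0) : x = F.point ν := by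
  conv_lhs => rw [F.eq_sum_dualVec x]
  rw [point, ← Finset.sum_neg_distrib]
  refine Finset.sum_congr rfl fun k _ => ?_
  rw [eq_neg_of_add_eq_zero_left (hx k), neg_smul]

theorem point_self : F.point μ = v :=
  (F.eq_point fun k => (F.tight_iff _).2 ⟨k, rfl⟩).symm

theorem continuous_point : Continuous F.point := by
  unfold point
  fun_prop

theorem eventually_slack_pos (hv : v ∈ polyhedron u μ) :
    ∀ᶠ ν in nhds μ, ∀ x, (∀ i ∈ Set.range F.facet, facetMap u x i + ν i = 0) →
      ∀ i ∉ Set.range F.facet, 0 < facetMap u x i + ν i := by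
  have hev : ∀ᶠ ν in nhds μ, ∀ i, i ∉ Set.range F.facet → 0 < facetMap u (F.point ν) i + ν i := by
    refine Filter.eventually_all.2 fun i => ?_
    by_cases hi : i ∈ Set.range F.facet
    · exact Filter.Eventually.of_forall fun ν h => absurd hi h
    · have hcont : Continuous fun ν => facetMap u (F.point ν) i + ν i :=
        ((continuous_apply i).comp ((continuous_facetMap u).comp F.continuous_point)).add
          (continuous_apply i)
      have hpos : 0 < facetMap u (F.point μ) i + μ i := by
        rw [F.point_self]
        exact lt_of_le_of_ne (mem_polyhedron.1 hv i) fun h => hi ((F.tight_iff i).1 h.symm)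
      filter_upwards [hcont.continuousAt.eventually (lt_mem_nhds hpos)] with ν hν _ using hν
  filter_upwards [hev] with ν hν x hx i hi
  rw [F.eq_point (ν := ν) (x := x) fun k => hx _ ⟨k, rfl⟩]
  exact hν i hi

end VertexFrame

/-- The combinatorial type of the polyhedron with facet constants `ν` is controlled by the
vertices `V` of the polyhedron with facet constants `μ`. -/
structure ControlledBy (u : Fin d → Fin n → ℤ) (μ : Fin d → ℝ) (V : Finset (Fin n → ℝ))
    (ν : Fin d → ℝ) : Prop where
  face : ∀ x ∈ polyhedron u ν, ∀ J : Finset (Fin d), (∀ j ∈ J, facetMap u x j + ν j = 0) →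
    ∃ v ∈ V, ∀ j ∈ J, facetMap u v j + μ j = 0
  vertex : ∀ v ∈ V, ∀ x, (∀ i, facetMap u v i + μ i = 0 → facetMap u x i + ν i = 0) →
    ∀ i, facetMap u v i + μ i ≠ 0 → 0 < facetMap u x i + ν i

theorem exists_vertex_of_face {u : Fin d → Fin n → ℤ} {μ : Fin d → ℝ}
    (hcomp : IsCompact (polyhedron u μ)) {V : Finset (Fin n → ℝ)}
    (hV : (V : Set (Fin n → ℝ)) = Set.extremePoints ℝ (polyhedron u μ))
    {x : Fin n → ℝ} (hx : x ∈ polyhedron u μ) {J : Finset (Fin d)}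
    (hJ : ∀ j ∈ J, facetMap u x j + μ j = 0) :
    ∃ v ∈ V, ∀ j ∈ J, facetMap u v j + μ j = 0 := by
  let Φ : Set (Fin n → ℝ) := {y ∈ polyhedron u μ | ∀ j ∈ J, facetMap u y j + μ j = 0}
  have hclosed : IsClosed {y : Fin n → ℝ | ∀ j ∈ J, facetMap u y j + μ j = 0} := by
    simp only [Set.ofPred_forall]
    exact isClosed_iInter fun j => isClosed_iInter fun _ => isClosed_eq
      (((continuous_apply j).comp (continuous_facetMap u)).add continuous_const) continuous_const
  have hΦc : IsCompact Φ := hcomp.inter_right hclosed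
  obtain ⟨v, hv⟩ := hΦc.extremePoints_nonempty ⟨x, hx, hJ⟩
  have hext : IsExtreme ℝ (polyhedron u μ) Φ := by
    refine ⟨fun y hy => hy.1, ?_⟩
    intro y hy z hz w hw hwyz
    refine ⟨hy, fun j hj => ?_⟩
    obtain ⟨a, b, ha, hb, hab, rfl⟩ := hwyz
    have h0 := hw.2 j hj
    rw [map_add, map_smul, map_smul] at h0
    simp only [Pi.add_apply, Pi.smul_apply, smul_eq_mul] at h0
    have h1 := mem_polyhedron.1 hy j
    have h2 := mem_polyhedron.1 hz j
    have h3 : a * (facetMap u y j + μ j) + b * (facetMap u z j + μ j) = 0 := by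
      linear_combination h0 + (μ j) * hab
    have h4 := mul_nonneg hb.le h2
    have h5 := mul_nonneg ha.le h1
    have h6 : a * (facetMap u y j + μ j) = 0 := by linarith
    exact (mul_eq_zero.1 h6).resolve_left ha.ne'
  refine ⟨v, ?_, hv.1.2⟩
  have := hext.extremePoints_subset_extremePoints hv
  rw [← hV] at this
  exact this

theorem eventually_controlledBy {u : Fin d → Fin n → ℤ} {μ : Fin d → ℝ}
    (hcomp : IsCompact (polyhedron u μ)) {x₀ : Fin n → ℝ}
    (hx₀ : ∀ i, 0 < facetMap u x₀ i + μ i) {V : Finset (Fin n → ℝ)}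
    (hV : (V : Set (Fin n → ℝ)) = Set.extremePoints ℝ (polyhedron u μ))
    (F : ∀ v ∈ V, VertexFrame u μ v) :
    ∀ᶠ ν in nhds μ, ControlledBy u μ V ν := by
  have hVmem : ∀ v ∈ V, v ∈ polyhedron u μ := fun v hv => by
    have : v ∈ (V : Set (Fin n → ℝ)) := hv
    rw [hV] at this
    exact this.1
  obtain ⟨R, hR⟩ := exists_eventually_norm_le hcomp hx₀
  have hface : ∀ᶠ ν in nhds μ, ∀ J : Finset (Fin d), ∀ x ∈ Metric.closedBall (0 : Fin n → ℝ) R,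
      (∀ i, 0 ≤ facetMap u x i + ν i) → (∀ j ∈ J, facetMap u x j + ν j = 0) →
      ∃ v ∈ V, ∀ j ∈ J, facetMap u v j + μ j = 0 := by
    refine Filter.eventually_all.2 fun J => ?_
    by_cases hJ : ∃ v ∈ V, ∀ j ∈ J, facetMap u v j + μ j = 0
    · exact Filter.Eventually.of_forall fun ν x _ _ _ => hJ
    refine (isCompact_closedBall (0 : Fin n → ℝ) R).eventually_forall_of_forall_eventually
      fun x _ => ?_
    let C : Set ((Fin d → ℝ) × (Fin n → ℝ)) :=
      {z | (∀ i, 0 ≤ facetMap u z.2 i + z.1 i) ∧ ∀ j ∈ J, facetMap u z.2 j + z.1 j = 0}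
    have hcont : ∀ i, Continuous fun z : (Fin d → ℝ) × (Fin n → ℝ) =>
        facetMap u z.2 i + z.1 i := fun i =>
      ((continuous_apply i).comp ((continuous_facetMap u).comp continuous_snd)).add
        ((continuous_apply i).comp continuous_fst)
    have hC : IsClosed C := by
      have hCeq : C = (⋂ i, {z | 0 ≤ facetMap u z.2 i + z.1 i}) ∩
          ⋂ j ∈ J, {z | facetMap u z.2 j + z.1 j = 0} := by
        ext z; simp [C]
      rw [hCeq]
      exact (isClosed_iInter fun i => isClosed_le continuous_const (hcont i)).inter
        (isClosed_biInter fun j _ => isClosed_eq (hcont j) continuous_const)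
    have hxC : (μ, x) ∉ C := fun h => hJ (exists_vertex_of_face hcomp hV h.1 h.2)
    have := hC.isOpen_compl.mem_nhds hxC
    filter_upwards [this] with z hz h1 h2 using absurd ⟨h1, h2⟩ hz
  have hvert : ∀ᶠ ν in nhds μ, ∀ v : V, ∀ x,
      (∀ i ∈ Set.range (F v v.2).facet, facetMap u x i + ν i = 0) →
      ∀ i ∉ Set.range (F v v.2).facet, 0 < facetMap u x i + ν i :=
    Filter.eventually_all.2 fun v => (F v v.2).eventually_slack_pos (hVmem v v.2)
  filter_upwards [hface, hvert, hR] with ν h1 h2 h3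
  refine ⟨fun x hx J hJ => h1 J x (by simpa using h3 x hx) hx hJ, fun v hv x hx i hi => ?_⟩
  exact h2 ⟨v, hv⟩ x (fun i hi => hx i (((F v hv).tight_iff i).2 hi)) i
    fun h => hi (((F v hv).tight_iff i).2 h)

end Geometry

section Transforms

variable {n d : ℕ}

namespace VertexFrame

variable {u : Fin d → Fin n → ℤ} {μ : Fin d → ℝ} {v : Fin n → ℝ} (F : VertexFrame u μ v)

/-- The value of `-ζ` at the perturbed vertex. -/
noncomputable def weight (ζ : (Fin n → ℝ) →ₗ[ℝ] ℝ) (ν : Fin d → ℝ) : ℝ :=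
  ∑ k, ζ (F.dualVec k) * ν (F.facet k)

theorem exp_neg_apply (ζ : (Fin n → ℝ) →ₗ[ℝ] ℝ) (ν : Fin d → ℝ) (x : Fin n → ℝ) :
    Complex.exp (-(ζ x : ℝ)) = Complex.exp (F.weight ζ ν) *
      ∏ k, Complex.exp (-(ζ (F.dualVec k) *
        (facetMap u x (F.facet k) + ν (F.facet k)) : ℝ)) := by
  rw [← Complex.exp_sum, ← Complex.exp_add]
  congr 1
  rw [F.apply_eq_sum ζ x, weight]
  push_cast
  rw [← Finset.sum_neg_distrib, ← Finset.sum_add_distrib]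
  exact Finset.sum_congr rfl fun k _ => by ring

end VertexFrame

theorem sum_prod_polarWeight {u : Fin d → Fin n → ℤ} {μ ν : Fin d → ℝ}
    {V : Finset (Fin n → ℝ)} (F : ∀ v : V, VertexFrame u μ v) (hν : ControlledBy u μ V ν)
    (hrec : ∀ z : Fin n → ℝ, z ≠ 0 → ∃ i, 0 < facetMap u z i)
    {ζ : (Fin n → ℝ) →ₗ[ℝ] ℝ} (hζ : ∀ v k, ζ ((F v).dualVec k) ≠ 0) (q : ℂ) (x : Fin n → ℝ) :
    ∑ v, ∏ k, polarWeight q (ζ ((F v).dualVec k))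
        (facetMap u x ((F v).facet k) + ν ((F v).facet k)) =
      ∏ i, facetWeight q (facetMap u x i + ν i) := by
  let I : V → Finset (Fin d) := fun v => Finset.univ.map ⟨(F v).facet, (F v).facet_injective⟩
  let c : V → Fin d → ℝ := fun v =>
    Function.extend (F v).facet (fun k => ζ ((F v).dualVec k)) 0
  let α : V → Fin d → Fin n → ℝ := fun v => Function.extend (F v).facet (F v).dualVec 0
  have hI : ∀ v i, i ∈ I v ↔ i ∈ Set.range (F v).facet := fun v i => by simp [I]
  have hcapp : ∀ v k, c v ((F v).facet k) = ζ ((F v).dualVec k) := fun v k =>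
    (F v).facet_injective.extend_apply _ _ k
  have hαapp : ∀ v k, α v ((F v).facet k) = (F v).dualVec k := fun v k =>
    (F v).facet_injective.extend_apply _ _ k
  have hdefect := polarDefect_eq_zero (Finset.univ : Finset V) I c (facetMap u) ζ α
    (Set.range fun z i => facetMap u z i + ν i) (J := ∅)
    (y := fun i => facetMap u x i + ν i) (b := fun i => facetWeight q (facetMap u x i + ν i))
    ?_ ?_ ?_ ?_ hrec ?_ ?_ ?_ ⟨x, rfl⟩ (by simp) ?_
  · rw [polarDefect, sub_eq_zero, Finset.compl_empty] at hdefect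
    rw [← hdefect]
    refine Finset.sum_congr (by simp) fun v _ => ?_
    rw [Finset.sdiff_empty, Finset.prod_map]
    refine Finset.prod_congr rfl fun k _ => ?_
    simp only [Function.Embedding.coeFn_mk, hcapp]
    rfl
  · rintro _ ⟨y, rfl⟩ z
    refine ⟨y + z, ?_⟩
    funext i
    simp only [map_add, Pi.add_apply]
    ring
  · rintro _ ⟨y, rfl⟩ hy J hJ
    obtain ⟨v, hv, hvJ⟩ := hν.face y hy J hJ
    exact ⟨⟨v, hv⟩, Finset.mem_univ _, fun j hj =>
      (hI _ _).2 (((F ⟨v, hv⟩).tight_iff j).1 (hvJ j hj))⟩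
  · rintro v - _ ⟨y, rfl⟩ hy i hi
    exact hν.vertex v v.2 y (fun j hj => hy j ((hI _ _).2 (((F v).tight_iff j).1 hj))) i
      fun h => hi ((hI _ _).2 (((F v).tight_iff i).1 h))
  · intro v _ v' _ hsub
    refine Subtype.ext ?_
    rw [(F v).eq_point (ν := μ) (x := v') fun k =>
      ((F v').tight_iff _).2 ((hI _ _).1 (hsub ((hI _ _).2 ⟨k, rfl⟩))), (F v).point_self]
  · intro v _ i hi j hj
    obtain ⟨k, rfl⟩ := (hI _ _).1 hi
    obtain ⟨l, rfl⟩ := (hI _ _).1 hj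
    rw [hαapp, (F v).facetMap_dualVec]
    simp [(F v).facet_injective.eq_iff]
  · intro v _ z
    rw [Finset.sum_map, (F v).apply_eq_sum ζ z]
    simp [hcapp]
  · intro v _ i hi
    obtain ⟨k, rfl⟩ := (hI _ _).1 hi
    rw [hcapp]
    exact hζ v k
  · intro i _
    refine ⟨fun h => if_pos h, fun h => ?_⟩
    rw [facetWeight, if_neg (not_lt.2 h.le), if_neg h.ne]

theorem hasSum_prod_facetWeight_mul_exp {u : Fin d → Fin n → ℤ} {μ : Fin d → ℝ}
    {V : Finset (Fin n → ℝ)} (F : ∀ v : V, VertexFrame u μ v) (hμ : ControlledBy u μ V μ)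
    (hrec : ∀ z : Fin n → ℝ, z ≠ 0 → ∃ i, 0 < facetMap u z i)
    {ζ : (Fin n → ℝ) →ₗ[ℝ] ℝ} (hζ : ∀ v k, ζ ((F v).dualVec k) ≠ 0) (q : ℂ) :
    HasSum (fun x : Fin n → ℤ =>
        (∏ i, facetWeight q (facetMap u (fun j => (x j : ℝ)) i + μ i)) *
          Complex.exp (-(ζ fun j => (x j : ℝ) : ℝ)))
      (∑ v, Complex.exp ((F v).weight ζ μ) *
        ∏ k, (q + 1 / (Complex.exp (ζ ((F v).dualVec k)) - 1))) := by
  have hvertex : ∀ v, HasSum (fun x : Fin n → ℤ =>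
      (∏ k, polarWeight q (ζ ((F v).dualVec k))
        (facetMap u (fun j => (x j : ℝ)) ((F v).facet k) + μ ((F v).facet k))) *
        Complex.exp (-(ζ fun j => (x j : ℝ) : ℝ)))
      (Complex.exp ((F v).weight ζ μ) *
        ∏ k, (q + 1 / (Complex.exp (ζ ((F v).dualVec k)) - 1))) := fun v => by
    have h := (hasSum_prod_mulVec (F v).mul_dual (F v).level
      fun k => hasSum_polarWeight_mul_exp q (hζ v k)).mul_left (Complex.exp ((F v).weight ζ μ))
    have hfun : (fun x : Fin n → ℤ =>
        (∏ k, polarWeight q (ζ ((F v).dualVec k))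
          (facetMap u (fun j => (x j : ℝ)) ((F v).facet k) + μ ((F v).facet k))) *
          Complex.exp (-(ζ fun j => (x j : ℝ) : ℝ))) = fun x : Fin n → ℤ =>
        Complex.exp ((F v).weight ζ μ) * ∏ k, polarWeight q (ζ ((F v).dualVec k))
          (((Matrix.of fun k => u ((F v).facet k)).mulVec x k + (F v).level k : ℤ) : ℝ) *
          Complex.exp (-(ζ ((F v).dualVec k) *
            (((Matrix.of fun k => u ((F v).facet k)).mulVec x k + (F v).level k : ℤ) : ℝ) : ℝ)) := by
      funext x
      have hslack : ∀ k, facetMap u (fun j => (x j : ℝ)) ((F v).facet k) + μ ((F v).facet k) =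
          (((Matrix.of fun k => u ((F v).facet k)).mulVec x k + (F v).level k : ℤ) : ℝ) := by
        intro k
        rw [(F v).level_eq, facetMap_apply, intPair]
        push_cast [Matrix.mulVec, dotProduct]
        rfl
      rw [(F v).exp_neg_apply ζ μ, Finset.prod_mul_distrib]
      simp only [hslack]
      ring
    rw [hfun]
    exact h
  have hsum := hasSum_sum (s := Finset.univ) fun v _ => hvertex v
  simp only [← Finset.sum_mul, sum_prod_polarWeight F hμ hrec hζ q] at hsum
  exact hsum

theorem integral_prod_facetWeight_mul_exp {u : Fin d → Fin n → ℤ} {μ ν : Fin d → ℝ}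
    {V : Finset (Fin n → ℝ)} (F : ∀ v : V, VertexFrame u μ v) (hν : ControlledBy u μ V ν)
    (hrec : ∀ z : Fin n → ℝ, z ≠ 0 → ∃ i, 0 < facetMap u z i)
    {ζ : (Fin n → ℝ) →ₗ[ℝ] ℝ} (hζ : ∀ v k, ζ ((F v).dualVec k) ≠ 0) :
    ∫ x : Fin n → ℝ, (∏ i, facetWeight 1 (facetMap u x i + ν i)) *
        Complex.exp (-(ζ x : ℝ)) =
      ∑ v, Complex.exp ((F v).weight ζ ν) * ∏ k, 1 / (ζ ((F v).dualVec k) : ℂ) := by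
  have hvertex : ∀ v, Integrable (fun x : Fin n → ℝ =>
      (∏ k, polarWeight 1 (ζ ((F v).dualVec k))
        (facetMap u x ((F v).facet k) + ν ((F v).facet k))) *
        Complex.exp (-(ζ x : ℝ))) ∧
      ∫ x : Fin n → ℝ, (∏ k, polarWeight 1 (ζ ((F v).dualVec k))
        (facetMap u x ((F v).facet k) + ν ((F v).facet k))) *
        Complex.exp (-(ζ x : ℝ)) =
      Complex.exp ((F v).weight ζ ν) * ∏ k, 1 / (ζ ((F v).dualVec k) : ℂ) := fun v => by
    have h := integral_prod_mulVec (F v).mul_dual (fun k => ν ((F v).facet k))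
      fun k => (integral_polarWeight_mul_exp (hζ v k)).1
    have hfun : (fun x : Fin n → ℝ =>
        (∏ k, polarWeight 1 (ζ ((F v).dualVec k))
          (facetMap u x ((F v).facet k) + ν ((F v).facet k))) *
          Complex.exp (-(ζ x : ℝ))) = fun x : Fin n → ℝ =>
        Complex.exp ((F v).weight ζ ν) * ∏ k, polarWeight 1 (ζ ((F v).dualVec k))
          (intPair (u ((F v).facet k)) x + ν ((F v).facet k)) *
          Complex.exp (-(ζ ((F v).dualVec k) *
            (intPair (u ((F v).facet k)) x + ν ((F v).facet k)) : ℝ)) := by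
      funext x
      rw [(F v).exp_neg_apply ζ ν, Finset.prod_mul_distrib]
      simp only [facetMap_apply]
      ring
    rw [hfun]
    refine ⟨h.1.const_mul _, ?_⟩
    rw [integral_const_mul]
    congr 1
    refine h.2.trans (Finset.prod_congr rfl fun k _ => ?_)
    exact (integral_polarWeight_mul_exp (hζ v k)).2
  have hsum := integral_finsetSum (μ := volume) Finset.univ fun v _ => (hvertex v).1
  simp only [← Finset.sum_mul, sum_prod_polarWeight F hν hrec hζ 1] at hsum
  rw [hsum]
  exact Finset.sum_congr rfl fun v _ => (hvertex v).2

theorem prod_facetWeight (q : ℂ) (u : Fin d → Fin n → ℤ) (ν : Fin d → ℝ) (x : Fin n → ℝ) :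
    ∏ i, facetWeight q (facetMap u x i + ν i) =
      if ∀ i, 0 ≤ intPair (u i) x + ν i then
        q ^ (Finset.univ.filter fun i => intPair (u i) x + ν i = 0).card else 0 := by
  simp only [facetMap_apply]
  split_ifs with h
  · rw [← Finset.prod_const, Finset.prod_filter]
    refine Finset.prod_congr rfl fun i _ => ?_
    rcases (h i).eq_or_lt with h0 | h0
    · rw [← h0, facetWeight, if_neg (lt_irrefl _), if_pos rfl, if_pos rfl]
    · rw [facetWeight, if_pos h0, if_neg h0.ne']
  · push Not at h
    obtain ⟨i, hi⟩ := h
    refine Finset.prod_eq_zero (Finset.mem_univ i) ?_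
    rw [facetWeight, if_neg hi.not_gt, if_neg hi.ne]

theorem integral_polyhedron_exp {u : Fin d → Fin n → ℤ} {μ ν : Fin d → ℝ}
    {V : Finset (Fin n → ℝ)} (F : ∀ v : V, VertexFrame u μ v) (hν : ControlledBy u μ V ν)
    (hrec : ∀ z : Fin n → ℝ, z ≠ 0 → ∃ i, 0 < facetMap u z i)
    {ζ : (Fin n → ℝ) →ₗ[ℝ] ℝ} (hζ : ∀ v k, ζ ((F v).dualVec k) ≠ 0) :
    ∫ x in polyhedron u ν, Complex.exp (-(ζ x : ℝ)) =
      ∑ v, Complex.exp ((F v).weight ζ ν) * ∏ k, 1 / (ζ ((F v).dualVec k) : ℂ) := by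
  rw [← integral_prod_facetWeight_mul_exp F hν hrec hζ,
    ← integral_indicator (isClosed_polyhedron u ν).measurableSet]
  refine integral_congr_ae (Filter.Eventually.of_forall fun x => ?_)
  simp only [prod_facetWeight, one_pow, ite_mul, one_mul, zero_mul]
  by_cases hx : x ∈ polyhedron u ν
  · rw [Set.indicator_of_mem hx]
    exact (if_pos hx).symm
  · rw [Set.indicator_of_notMem hx]
    exact (if_neg hx).symm

end Transforms

section PowerMoments

variable {n d : ℕ}

open Asymptotics Filter Topology in
theorem HasExpansion.setIntegral_exp {s : Set (Fin n → ℝ)} (hs : IsCompact s)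
    {w : (Fin n → ℝ) → ℂ} (hw : Continuous w) :
    HasExpansion (fun t => ∫ x in s, Complex.exp (w x * t))
      (PowerSeries.mk fun m => ∫ x in s, w x ^ m / m.factorial) := by
  obtain ⟨R, hR⟩ := hs.exists_bound_of_continuousOn hw.continuousOn
  intro N
  refine ⟨_, X_pow_dvd_sub_trunc _ N,
    IsBigO.of_bound (R ^ N * Real.exp R * volume.real s) ?_⟩
  have h1 : ∀ᶠ t : ℝ in 𝓝[>] 0, t ≤ 1 :=
    (eventually_le_nhds one_pos).filter_mono nhdsWithin_le_nhds
  filter_upwards [self_mem_nhdsWithin, h1] with t ht ht1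
  have ht0 : (0 : ℝ) ≤ t := le_of_lt ht
  have hint : ∀ k, IntegrableOn (fun x => w x ^ k / k.factorial * (t : ℂ) ^ k) s := fun k =>
    (((hw.pow k).div_const _).mul continuous_const).continuousOn.integrableOn_compact hs
  have hexp : IntegrableOn (fun x => Complex.exp (w x * t)) s :=
    (Complex.continuous_exp.comp (hw.mul continuous_const)).continuousOn.integrableOn_compact hs
  have heval : (PowerSeries.trunc N (PowerSeries.mk fun m => ∫ x in s, w x ^ m / m.factorial)).eval
      (t : ℂ) = ∫ x in s, ∑ k ∈ Finset.range N, w x ^ k / k.factorial * (t : ℂ) ^ k := by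
    rw [integral_finsetSum _ fun k _ => hint k, PowerSeries.trunc_apply, Polynomial.eval_finsetSum,
      Nat.Ico_zero_eq_range]
    refine Finset.sum_congr rfl fun k _ => ?_
    rw [integral_mul_const]
    simp
  rw [heval, ← integral_sub hexp (integrable_finsetSum _ fun k _ => hint k)]
  refine (norm_setIntegral_le_of_norm_le_const hs.measure_lt_top
    (C := R ^ N * Real.exp R * t ^ N) fun x hx =>
      norm_exp_sub_trunc_le (w x) (hR x hx) ht0 ht1 N).trans ?_
  rw [Real.norm_of_nonneg (pow_nonneg ht0 N)]
  apply le_of_eq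
  ring

theorem VertexFrame.weight_smul {u : Fin d → Fin n → ℤ} {μ : Fin d → ℝ} {v : Fin n → ℝ}
    (F : VertexFrame u μ v) (t : ℝ) (ζ : (Fin n → ℝ) →ₗ[ℝ] ℝ) (ν : Fin d → ℝ) :
    F.weight (t • ζ) ν = F.weight ζ ν * t := by
  rw [weight, weight, Finset.sum_mul]
  refine Finset.sum_congr rfl fun k _ => ?_
  rw [LinearMap.smul_apply, smul_eq_mul]
  ring

theorem integral_polyhedron_pow {u : Fin d → Fin n → ℤ} {μ ν : Fin d → ℝ}
    {V : Finset (Fin n → ℝ)} (F : ∀ v : V, VertexFrame u μ v) (hν : ControlledBy u μ V ν)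
    (hrec : ∀ z : Fin n → ℝ, z ≠ 0 → ∃ i, 0 < facetMap u z i)
    (hcomp : IsCompact (polyhedron u ν))
    {ζ : (Fin n → ℝ) →ₗ[ℝ] ℝ} (hζ : ∀ v k, ζ ((F v).dualVec k) ≠ 0) (m : ℕ) :
    ∫ x in polyhedron u ν, (-(ζ x : ℂ)) ^ m / m.factorial =
      ∑ v, PowerSeries.coeff (m + n)
        (PowerSeries.C (∏ k, 1 / (ζ ((F v).dualVec k) : ℂ)) *
          PowerSeries.rescale ((F v).weight ζ ν : ℂ) (PowerSeries.exp ℂ)) := by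
  have hcont : Continuous fun x => -(ζ x : ℂ) :=
    (Complex.continuous_ofReal.comp (LinearMap.continuous_of_finiteDimensional ζ)).neg
  have h1 := (HasExpansion.setIntegral_exp hcomp hcont).mul (HasExpansion.ofReal_pow n)
  have h2 := HasExpansion.sum Finset.univ fun v _ =>
    (HasExpansion.exp ((F v).weight ζ ν : ℂ)).const_mul (∏ k, 1 / (ζ ((F v).dualVec k) : ℂ))
  have heq : (fun t : ℝ => (∫ x in polyhedron u ν, Complex.exp (-(ζ x : ℂ) * t)) * (t : ℂ) ^ n)
      =ᶠ[nhdsWithin 0 (Set.Ioi 0)] fun t : ℝ => ∑ v, (∏ k, 1 / (ζ ((F v).dualVec k) : ℂ)) *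
        Complex.exp ((F v).weight ζ ν * t) := by
    filter_upwards [self_mem_nhdsWithin] with t ht
    have ht' : (t : ℂ) ≠ 0 := by exact_mod_cast (ne_of_gt ht : t ≠ 0)
    have h := integral_polyhedron_exp F hν hrec (ζ := t • ζ) fun v k => by
      simpa using ⟨(ne_of_gt ht : t ≠ 0), hζ v k⟩
    have hfun : (fun x => Complex.exp (-(ζ x : ℂ) * t)) =
        fun x => Complex.exp (-((t • ζ) x : ℝ)) := by
      funext x
      congr 1
      rw [LinearMap.smul_apply, smul_eq_mul]
      push_cast
      ring
    rw [hfun, h, Finset.sum_mul]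
    refine Finset.sum_congr rfl fun v _ => ?_
    rw [VertexFrame.weight_smul]
    simp only [LinearMap.smul_apply, smul_eq_mul, Complex.ofReal_mul, one_div, mul_inv,
      Finset.prod_mul_distrib, Finset.prod_const, Finset.card_univ, Fintype.card_fin, inv_pow]
    field_simp
  have h := congrArg (PowerSeries.coeff (m + n)) ((h1.congr heq).unique h2)
  rw [PowerSeries.coeff_mul_X_pow, PowerSeries.coeff_mk, map_sum] at h
  exact h

theorem sum_lattice_pow {u : Fin d → Fin n → ℤ} {μ : Fin d → ℝ}
    {V : Finset (Fin n → ℝ)} (F : ∀ v : V, VertexFrame u μ v) (hμ : ControlledBy u μ V μ)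
    (hrec : ∀ z : Fin n → ℝ, z ≠ 0 → ∃ i, 0 < facetMap u z i)
    {L : Finset (Fin n → ℤ)} (hL : ∀ x : Fin n → ℤ, (fun j => (x j : ℝ)) ∈ polyhedron u μ → x ∈ L)
    {ζ : (Fin n → ℝ) →ₗ[ℝ] ℝ} (hζ : ∀ v k, ζ ((F v).dualVec k) ≠ 0) (q : ℂ) (m : ℕ) :
    ∑ x ∈ L, (∏ i, facetWeight q (facetMap u (fun j => (x j : ℝ)) i + μ i)) *
        ((-(ζ fun j => (x j : ℝ) : ℂ)) ^ m / m.factorial) =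
      ∑ v, PowerSeries.coeff (m + n)
        (PowerSeries.C (∏ k, 1 / (ζ ((F v).dualVec k) : ℂ)) *
          ((∏ k, PowerSeries.rescale (ζ ((F v).dualVec k) : ℂ) (chiSeries q)) *
          PowerSeries.rescale ((F v).weight ζ μ : ℂ) (PowerSeries.exp ℂ))) := by
  have h1 := (HasExpansion.sum L fun x _ =>
    (HasExpansion.exp (-(ζ fun j => (x j : ℝ) : ℂ))).const_mul
      (∏ i, facetWeight q (facetMap u (fun j => (x j : ℝ)) i + μ i))).mul
    (HasExpansion.ofReal_pow n)
  have h2 := HasExpansion.sum Finset.univ fun v _ =>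
    (HasExpansion.exp ((F v).weight ζ μ : ℂ)).mul
      (HasExpansion.prod Finset.univ fun k _ => hasExpansion_chiSeries q (hζ v k))
  have heq : (fun t : ℝ => (∑ x ∈ L,
        (∏ i, facetWeight q (facetMap u (fun j => (x j : ℝ)) i + μ i)) *
          Complex.exp (-(ζ fun j => (x j : ℝ) : ℂ) * t)) * (t : ℂ) ^ n)
      =ᶠ[nhdsWithin 0 (Set.Ioi 0)] fun t : ℝ => ∑ v, Complex.exp ((F v).weight ζ μ * t) *
        ∏ k, (t : ℂ) * (q + 1 / (Complex.exp (ζ ((F v).dualVec k) * t) - 1)) := by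
    filter_upwards [self_mem_nhdsWithin] with t ht
    have h := hasSum_prod_facetWeight_mul_exp F hμ hrec (ζ := t • ζ) (fun v k => by
      simpa using ⟨(ne_of_gt ht : t ≠ 0), hζ v k⟩) q
    have hsum := h.unique (hasSum_sum_of_ne_finset_zero (s := L) fun x hx => by
      have hx' : ¬ ∀ i, 0 ≤ intPair (u i) (fun j => (x j : ℝ)) + μ i := fun h => hx (hL x h)
      rw [prod_facetWeight, if_neg hx', zero_mul])
    have hfun : ∀ x : Fin n → ℤ, Complex.exp (-(ζ fun j => (x j : ℝ) : ℂ) * t) =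
        Complex.exp (-((t • ζ) fun j => (x j : ℝ) : ℝ)) := by
      intro x
      congr 1
      rw [LinearMap.smul_apply, smul_eq_mul]
      push_cast
      ring
    simp only [hfun]
    rw [← hsum, Finset.sum_mul]
    refine Finset.sum_congr rfl fun v _ => ?_
    rw [VertexFrame.weight_smul]
    simp only [LinearMap.smul_apply, smul_eq_mul, Complex.ofReal_mul,
      Finset.prod_mul_distrib, Finset.prod_const, Finset.card_univ, Fintype.card_fin]
    simp only [mul_comm (t : ℂ)]
    ring
  have h := congrArg (PowerSeries.coeff (m + n)) ((h1.congr heq).unique h2)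
  rw [PowerSeries.coeff_mul_X_pow, map_sum, map_sum] at h
  simp only [Finset.prod_mul_distrib] at h
  convert h using 1
  · refine Finset.sum_congr rfl fun x _ => ?_
    rw [PowerSeries.coeff_C_mul, PowerSeries.coeff_rescale, PowerSeries.coeff_exp]
    simp [div_eq_mul_inv]
  · refine Finset.sum_congr rfl fun v _ => ?_
    rw [map_prod]
    congr 1
    ring

end PowerMoments

section DifferentialOperator

variable {d : ℕ}

theorem coordPartial_congr {H G : (Fin d → ℝ) → ℂ} {x : Fin d → ℝ} (i : Fin d)
    (h : H =ᶠ[nhds x] G) : coordPartial i H =ᶠ[nhds x] coordPartial i G := by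
  filter_upwards [h.fderiv (𝕜 := ℝ)] with y hy
  rw [coordPartial, coordPartial, hy]

theorem mixedPartial_congr {H G : (Fin d → ℝ) → ℂ} {x : Fin d → ℝ} (j : Fin d → ℕ)
    (h : H =ᶠ[nhds x] G) : mixedPartial j H x = mixedPartial j G x := by
  have hiter : ∀ (i : Fin d) (m : ℕ) {H G : (Fin d → ℝ) → ℂ}, H =ᶠ[nhds x] G →
      (coordPartial i)^[m] H =ᶠ[nhds x] (coordPartial i)^[m] G := by
    intro i m
    induction m with
    | zero => exact fun h => h
    | succ m ih => exact fun h => ih (coordPartial_congr i h)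
  have hlist : ∀ l : List (Fin d),
      l.foldr (fun i G => (coordPartial i)^[j i] G) H =ᶠ[nhds x]
        l.foldr (fun i G => (coordPartial i)^[j i] G) G := by
    intro l
    induction l with
    | nil => exact h
    | cons i l ih => exact hiter i (j i) ih
  exact (hlist _).eq_of_nhds

/-- If coordinate partial derivatives act on a parametrized family of functions through operators
of the parameter, so do mixed partial derivatives. -/
theorem mixedPartial_family {A : Type*} (Φ : A → (Fin d → ℝ) → ℂ) (D : Fin d → A → A)
    (hD : ∀ i a, coordPartial i (Φ a) = Φ (D i a)) (j : Fin d → ℕ) (a : A) :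
    mixedPartial j (Φ a) = Φ ((List.finRange d).foldr (fun i b => (D i)^[j i] b) a) := by
  have hiter : ∀ (i : Fin d) (m : ℕ) (a : A),
      (coordPartial i)^[m] (Φ a) = Φ ((D i)^[m] a) := by
    intro i m
    induction m with
    | zero => exact fun a => rfl
    | succ m ih => intro a; rw [Function.iterate_succ_apply, hD, ih, Function.iterate_succ_apply]
  unfold mixedPartial
  induction List.finRange d with
  | nil => rfl
  | cons i l ih => rw [List.foldr_cons, ih, hiter, List.foldr_cons]

theorem hasFDerivAt_eval_ofReal (P : MvPolynomial (Fin d) ℂ) (x : Fin d → ℝ) :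
    HasFDerivAt (fun h : Fin d → ℝ => MvPolynomial.eval (fun i => (h i : ℂ)) P)
      (∑ i, (ContinuousLinearMap.proj (R := ℝ) (φ := fun _ : Fin d => ℝ) i).smulRight
        (MvPolynomial.eval (fun i => (x i : ℂ)) (MvPolynomial.pderiv i P))) x := by
  induction P using MvPolynomial.induction_on with
  | C a =>
    simp only [MvPolynomial.eval_C, MvPolynomial.pderiv_C, map_zero]
    refine (hasFDerivAt_const a x).congr_fderiv ?_
    ext; simp
  | add P Q hP hQ =>
    simp only [map_add]
    refine (hP.fun_add hQ).congr_fderiv ?_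
    rw [← Finset.sum_add_distrib]
    refine Finset.sum_congr rfl fun i _ => ?_
    ext; simp
  | mul_X P k hP =>
    have hX : HasFDerivAt (fun h : Fin d → ℝ => (h k : ℂ))
        (Complex.ofRealCLM.comp (ContinuousLinearMap.proj (R := ℝ) (φ := fun _ : Fin d => ℝ) k))
        x :=
      (Complex.ofRealCLM.comp
        (ContinuousLinearMap.proj (R := ℝ) (φ := fun _ : Fin d => ℝ) k)).hasFDerivAt
    simp only [map_mul, MvPolynomial.eval_X]
    refine (hP.fun_mul hX).congr_fderiv ?_
    ext v
    simp only [Derivation.leibniz, MvPolynomial.pderiv_X, smul_eq_mul, map_add, map_mul,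
      MvPolynomial.eval_X, sum_apply, ContinuousLinearMap.smulRight_apply,
      ContinuousLinearMap.proj_apply, add_apply, smul_apply, ContinuousLinearMap.comp_apply,
      Complex.ofRealCLM_apply, Complex.real_smul, mul_add, Finset.sum_add_distrib, Finset.mul_sum]
    congr 1
    · rw [Finset.sum_eq_single k]
      · simp; ring
      · intro i _ hi
        simp [hi.symm]
      · simp
    · exact Finset.sum_congr rfl fun i _ => by ring

theorem coordPartial_eval (i : Fin d) (P : MvPolynomial (Fin d) ℂ) :
    coordPartial i (fun h : Fin d → ℝ => MvPolynomial.eval (fun i => (h i : ℂ)) P) =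
      fun h => MvPolynomial.eval (fun i => (h i : ℂ)) (MvPolynomial.pderiv i P) := by
  funext x
  rw [coordPartial, (hasFDerivAt_eval_ofReal P x).fderiv]
  simp [Pi.single_apply]

/-- The truncated operator `∏ᵢ χ_q(∂/∂hᵢ)` at the origin, as a linear functional on
polynomials. -/
theorem exists_linearMap_mixedPartial (S : Finset (Fin d → ℕ)) (a : (Fin d → ℕ) → ℂ) :
    ∃ T : MvPolynomial (Fin d) ℂ →ₗ[ℂ] ℂ, ∀ P, T P = ∑ j ∈ S, a j *
      mixedPartial j (fun h : Fin d → ℝ => MvPolynomial.eval (fun i => (h i : ℂ)) P) 0 := by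
  let D : (Fin d → ℕ) → MvPolynomial (Fin d) ℂ →ₗ[ℂ] MvPolynomial (Fin d) ℂ := fun j =>
    (List.finRange d).foldr (fun i E => (MvPolynomial.pderiv i).toLinearMap ^ j i * E) 1
  have hD : ∀ j P, D j P =
      (List.finRange d).foldr (fun i b => (MvPolynomial.pderiv i)^[j i] b) P := by
    intro j P
    simp only [D]
    induction List.finRange d with
    | nil => rfl
    | cons i l ih =>
      rw [List.foldr_cons, List.foldr_cons, ← ih, Module.End.mul_apply, Module.End.pow_apply]
      rfl
  refine ⟨∑ j ∈ S, a j • ((MvPolynomial.aeval fun _ => (0 : ℂ)).toLinearMap ∘ₗ D j),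
    fun P => ?_⟩
  rw [LinearMap.sum_apply]
  refine Finset.sum_congr rfl fun j _ => ?_
  have h := mixedPartial_family
    (fun (P : MvPolynomial (Fin d) ℂ) (h : Fin d → ℝ) =>
      MvPolynomial.eval (fun i => (h i : ℂ)) P)
    (fun i => MvPolynomial.pderiv i) coordPartial_eval j P
  rw [h, ← hD]
  simp

open PowerSeries in
theorem hasDerivAt_coeff_mul_rescale_exp (M : ℕ) (φ : PowerSeries ℂ) (w : ℂ) :
    HasDerivAt (fun w => coeff M (φ * rescale w (exp ℂ)))
      (coeff M (φ * (X * rescale w (exp ℂ)))) w := by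
  have hcoeff : ∀ b, HasDerivAt (fun w => coeff b (rescale w (exp ℂ)))
      (coeff b (X * rescale w (exp ℂ))) w := by
    intro b
    cases b with
    | zero => simpa using hasDerivAt_const w (1 : ℂ)
    | succ b =>
      rw [coeff_succ_X_mul]
      simp only [coeff_rescale, coeff_exp]
      refine ((hasDerivAt_pow (b + 1) w).mul_const
        (algebraMap ℚ ℂ (1 / (b + 1).factorial))).congr_deriv ?_
      rw [Nat.factorial_succ]
      have : ((b : ℂ) + 1) ≠ 0 := by exact_mod_cast b.succ_ne_zero
      have h2 : (b.factorial : ℂ) ≠ 0 := by exact_mod_cast b.factorial_ne_zero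
      simp
      field_simp
  simp only [coeff_mul M]
  exact HasDerivAt.fun_sum fun p _ => (hcoeff p.2).const_mul _

open PowerSeries in
theorem coordPartial_coeff_mul_rescale_exp (M : ℕ) (w₀ : ℂ) (W : (Fin d → ℝ) →L[ℝ] ℂ)
    (i : Fin d) (φ : PowerSeries ℂ) :
    coordPartial i (fun h => coeff M (φ * rescale (w₀ + W h) (exp ℂ))) = fun h =>
      coeff M (C (W (Pi.single i 1)) * X * φ * rescale (w₀ + W h) (exp ℂ)) := by
  funext h
  have h1 := (hasDerivAt_coeff_mul_rescale_exp M φ (w₀ + W h)).hasFDerivAt.restrictScalars ℝ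
  have h2 : HasFDerivAt (fun h => w₀ + W h) W h := W.hasFDerivAt.const_add w₀
  have h3 := h1.comp h h2
  rw [coordPartial]
  erw [h3.fderiv]
  simp only [ContinuousLinearMap.comp_apply, ContinuousLinearMap.coe_restrictScalars',
    ContinuousLinearMap.toSpanSingleton_apply, smul_eq_mul]
  rw [← coeff_C_mul]
  congr 1
  ring

open PowerSeries in
theorem mixedPartial_coeff_mul_rescale_exp (M : ℕ) (w₀ : ℂ) (W : (Fin d → ℝ) →L[ℝ] ℂ)
    (j : Fin d → ℕ) (φ : PowerSeries ℂ) :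
    mixedPartial j (fun h => coeff M (φ * rescale (w₀ + W h) (exp ℂ))) = fun h =>
      coeff M ((∏ i, (C (W (Pi.single i 1)) * X) ^ j i) * φ * rescale (w₀ + W h) (exp ℂ)) := by
  rw [mixedPartial_family (fun φ h => coeff M (φ * rescale (w₀ + W h) (exp ℂ)))
    (fun i φ => C (W (Pi.single i 1)) * X * φ)
    (coordPartial_coeff_mul_rescale_exp M w₀ W) j φ]
  have hlist : ∀ l : List (Fin d),
      l.foldr (fun i b => (fun φ : PowerSeries ℂ => C (W (Pi.single i 1)) * X * φ)^[j i] b) φ =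
        (l.map fun i => (C (W (Pi.single i 1)) * X) ^ j i).prod * φ := by
    intro l
    induction l with
    | nil => simp
    | cons i l ih => rw [List.foldr_cons, ih, mul_left_iterate_apply, List.map_cons,
        List.prod_cons, mul_assoc]
  rw [hlist, ← List.ofFn_eq_map, List.prod_ofFn]

theorem dvd_prod_sub_prod {R ι : Type*} [CommRing R] {r : R} (s : Finset ι) {f g : ι → R}
    (h : ∀ i ∈ s, r ∣ f i - g i) : r ∣ ∏ i ∈ s, f i - ∏ i ∈ s, g i := by
  induction s using Finset.induction_on with
  | empty => simp
  | insert a s ha ih =>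
    rw [Finset.prod_insert ha, Finset.prod_insert ha]
    exact dvd_mul_sub_mul (h a (Finset.mem_insert_self _ _))
      (ih fun i hi => h i (Finset.mem_insert_of_mem hi))

open PowerSeries in
theorem sum_mixedPartial_coeff_mul_rescale_exp (q : ℂ) {M N : ℕ} (hMN : M < N) (w₀ : ℂ)
    (W : (Fin d → ℝ) →L[ℝ] ℂ) (φ : PowerSeries ℂ) :
    ∑ j ∈ Fintype.piFinset (fun _ : Fin d => Finset.range N), (∏ i, chiCoeff q (j i)) *
        mixedPartial j (fun h => coeff M (φ * rescale (w₀ + W h) (exp ℂ))) 0 =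
      coeff M ((∏ i, rescale (W (Pi.single i 1)) (chiSeries q)) * φ * rescale w₀ (exp ℂ)) := by
  have hterm : ∀ j : Fin d → ℕ, (∏ i, chiCoeff q (j i)) *
        mixedPartial j (fun h => coeff M (φ * rescale (w₀ + W h) (exp ℂ))) 0 =
      coeff M ((∏ i, C (chiCoeff q (j i)) * (C (W (Pi.single i 1)) * X) ^ j i) *
        (φ * rescale w₀ (exp ℂ))) := by
    intro j
    rw [mixedPartial_coeff_mul_rescale_exp, ← coeff_C_mul, map_prod, Finset.prod_mul_distrib,
      map_zero, add_zero]
    congr 1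
    ring
  simp only [hterm]
  rw [← map_sum, ← Finset.sum_mul, ← Finset.prod_univ_sum (fun _ => Finset.range N)
    (fun i s => C (chiCoeff q s) * (C (W (Pi.single i 1)) * X) ^ s)]
  rw [← sub_eq_zero, ← map_sub, mul_assoc, ← sub_mul]
  refine X_pow_dvd_iff.1 (Dvd.dvd.mul_right ?_ _) M hMN
  refine dvd_prod_sub_prod _ fun i _ => X_pow_dvd_iff.2 fun m hm => ?_
  rw [map_sub, map_sum, sub_eq_zero]
  have : ∀ s, coeff m (C (chiCoeff q s) * (C (W (Pi.single i 1)) * X) ^ s) =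
      if m = s then chiCoeff q s * W (Pi.single i 1) ^ s else 0 := by
    intro s
    rw [mul_pow, ← map_pow, ← mul_assoc, ← map_mul, coeff_C_mul, coeff_X_pow]
    simp
  simp only [this]
  rw [Finset.sum_ite_eq, if_pos (Finset.mem_range.2 hm), coeff_rescale, chiSeries, coeff_mk,
    mul_comm]

end DifferentialOperator

section Assembly

variable {n d : ℕ}

open PowerSeries in
theorem exists_eval_eq_coeff_mul_rescale_exp (a w₀ : ℂ) (W : (Fin d → ℝ) →L[ℝ] ℂ) (M : ℕ) :
    ∃ P : MvPolynomial (Fin d) ℂ, ∀ h : Fin d → ℝ,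
      MvPolynomial.eval (fun i => (h i : ℂ)) P = coeff M (C a * rescale (w₀ + W h) (exp ℂ)) := by
  refine ⟨MvPolynomial.C (a / M.factorial) * (MvPolynomial.C w₀ +
    ∑ i, MvPolynomial.C (W (Pi.single i 1)) * MvPolynomial.X i) ^ M, fun h => ?_⟩
  have hW : W h = ∑ i, W (Pi.single i 1) * h i := by
    conv_lhs => rw [← Finset.univ_sum_single h, map_sum]
    refine Finset.sum_congr rfl fun i _ => ?_
    have hsingle : (Pi.single i (h i) : Fin d → ℝ) = h i • Pi.single i 1 := by
      rw [← Pi.single_smul', smul_eq_mul, mul_one]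
    rw [hsingle, map_smul, Complex.real_smul, mul_comm]
  rw [coeff_C_mul, coeff_rescale, coeff_exp, hW]
  simp
  ring

namespace VertexFrame

variable {u : Fin d → Fin n → ℤ} {μ : Fin d → ℝ} {v : Fin n → ℝ} (F : VertexFrame u μ v)

/-- The linear part of the weight, as a continuous linear map. -/
noncomputable def weightCLM (ζ : (Fin n → ℝ) →ₗ[ℝ] ℝ) : (Fin d → ℝ) →L[ℝ] ℂ :=
  Complex.ofRealCLM.comp (∑ k, ζ (F.dualVec k) • ContinuousLinearMap.proj (F.facet k))

theorem weightCLM_apply (ζ : (Fin n → ℝ) →ₗ[ℝ] ℝ) (h : Fin d → ℝ) :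
    F.weightCLM ζ h = F.weight ζ h := by
  simp [weightCLM, weight]

theorem weight_add (ζ : (Fin n → ℝ) →ₗ[ℝ] ℝ) (ν h : Fin d → ℝ) :
    F.weight ζ (fun i => ν i + h i) = F.weight ζ ν + F.weight ζ h := by
  simp only [weight, mul_add, Finset.sum_add_distrib]

theorem dualVec_ne_zero (k : Fin n) : F.dualVec k ≠ 0 := by
  intro h
  have := F.facetMap_dualVec k k
  rw [h] at this
  simp at this

theorem prod_rescale_weightCLM (ζ : (Fin n → ℝ) →ₗ[ℝ] ℝ) (q : ℂ) :
    ∏ i, PowerSeries.rescale (F.weightCLM ζ (Pi.single i 1)) (chiSeries q) =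
      ∏ k, PowerSeries.rescale (ζ (F.dualVec k) : ℂ) (chiSeries q) := by
  have hfacet : ∀ k, F.weightCLM ζ (Pi.single (F.facet k) 1) = ζ (F.dualVec k) := by
    intro k
    rw [weightCLM_apply, weight, Finset.sum_eq_single k]
    · simp
    · intro l _ hl
      rw [Pi.single_eq_of_ne (F.facet_injective.ne hl), mul_zero]
    · simp
  rw [← Finset.prod_congr rfl fun k _ => congrArg
    (fun c => PowerSeries.rescale c (chiSeries q)) (hfacet k)]
  rw [← Finset.prod_image (s := Finset.univ) (g := F.facet)
    (f := fun i => PowerSeries.rescale (F.weightCLM ζ (Pi.single i 1)) (chiSeries q))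
    F.facet_injective.injOn]
  symm
  refine Finset.prod_subset (Finset.subset_univ _) fun i _ hi => ?_
  have hzero : F.weightCLM ζ (Pi.single i 1) = 0 := by
    rw [weightCLM_apply, weight, Finset.sum_eq_zero, Complex.ofReal_zero]
    intro k _
    rw [Pi.single_eq_of_ne, mul_zero]
    rintro rfl
    exact hi (Finset.mem_image_of_mem _ (Finset.mem_univ k))
  rw [hzero, PowerSeries.rescale_zero_apply, constantCoeff_chiSeries, map_one]

end VertexFrame

theorem exists_mvPolynomial_integral_pow {u : Fin d → Fin n → ℤ} {μ : Fin d → ℝ}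
    {V : Finset (Fin n → ℝ)} (F : ∀ v : V, VertexFrame u μ v)
    (hctrl : ∀ᶠ ν in nhds μ, ControlledBy u μ V ν)
    (hcomp : ∀ᶠ ν in nhds μ, IsCompact (polyhedron u ν))
    (hrec : ∀ z : Fin n → ℝ, z ≠ 0 → ∃ i, 0 < facetMap u z i)
    {L : Finset (Fin n → ℤ)} (hL : ∀ x : Fin n → ℤ, (fun j => (x j : ℝ)) ∈ polyhedron u μ → x ∈ L)
    {ζ : (Fin n → ℝ) →ₗ[ℝ] ℝ} (hζ : ∀ v k, ζ ((F v).dualVec k) ≠ 0) (q : ℂ) (m : ℕ) :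
    ∃ P : MvPolynomial (Fin d) ℂ,
      (∀ᶠ h in nhds (0 : Fin d → ℝ),
        ∫ x in polyhedron u (fun i => μ i + h i), (-(ζ x : ℂ)) ^ m / m.factorial =
          MvPolynomial.eval (fun i => (h i : ℂ)) P) ∧
      ∀ N, m + n < N →
        ∑ x ∈ L, (∏ i, facetWeight q (facetMap u (fun j => (x j : ℝ)) i + μ i)) *
            ((-(ζ fun j => (x j : ℝ) : ℂ)) ^ m / m.factorial) =
          ∑ j ∈ Fintype.piFinset (fun _ : Fin d => Finset.range N), (∏ i, chiCoeff q (j i)) *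
            mixedPartial j (fun h => MvPolynomial.eval (fun i => (h i : ℂ)) P) 0 := by
  choose Q hQ using fun v => exists_eval_eq_coeff_mul_rescale_exp
    (∏ k, 1 / (ζ ((F v).dualVec k) : ℂ)) ((F v).weight ζ μ) ((F v).weightCLM ζ) (m + n)
  have htendsto : Filter.Tendsto (fun h : Fin d → ℝ => fun i => μ i + h i) (nhds 0) (nhds μ) := by
    have : Continuous fun h : Fin d → ℝ => fun i => μ i + h i := by fun_prop
    simpa using this.tendsto 0
  refine ⟨∑ v, Q v, ?_, fun N hN => ?_⟩
  · filter_upwards [htendsto.eventually hctrl, htendsto.eventually hcomp] with h h1 h2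
    rw [integral_polyhedron_pow F h1 hrec h2 hζ m, map_sum]
    refine Finset.sum_congr rfl fun v _ => ?_
    rw [hQ, (F v).weight_add, (F v).weightCLM_apply, Complex.ofReal_add]
  · obtain ⟨T, hT⟩ := exists_linearMap_mixedPartial
      (Fintype.piFinset (fun _ : Fin d => Finset.range N)) (fun j => ∏ i, chiCoeff q (j i))
    rw [← hT, map_sum, sum_lattice_pow F hctrl.self_of_nhds hrec hL hζ q m]
    refine Finset.sum_congr rfl fun v _ => ?_
    rw [hT]
    simp only [hQ]
    rw [sum_mixedPartial_coeff_mul_rescale_exp q hN, (F v).prod_rescale_weightCLM]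
    congr 1
    ring

/-- Powers of real linear forms outside the zero locus of a nonzero polynomial span the
polynomials of bounded degree. -/
theorem mem_span_linearForm_pow {f : MvPolynomial (Fin n) ℝ} (hf : f ≠ 0) {D : ℕ}
    {p : MvPolynomial (Fin n) ℂ} (hp : p.totalDegree ≤ D) :
    p ∈ Submodule.span ℂ {g : MvPolynomial (Fin n) ℂ | ∃ m ≤ D, ∃ c : Fin n → ℝ,
      MvPolynomial.eval c f ≠ 0 ∧
        g = (∑ j, MvPolynomial.C (c j : ℂ) * MvPolynomial.X j) ^ m} := by
  rw [← Subspace.forall_mem_dualAnnihilator_apply_eq_zero_iff]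
  intro φ hφ
  rw [Submodule.mem_dualAnnihilator] at hφ
  have hmon : ∀ s : Fin n →₀ ℕ, ∑ j, s j ≤ D → φ (MvPolynomial.monomial s 1) = 0 := by
    intro s hs
    set m := ∑ j, s j with hm
    let e : (Fin n → ℕ) → (Fin n →₀ ℕ) := Finsupp.equivFunOnFinite.symm
    let G : MvPolynomial (Fin n) ℂ := ∑ k ∈ Finset.univ.piAntidiag m,
      MvPolynomial.monomial (e k)
        ((Nat.multinomial Finset.univ k : ℂ) * φ (MvPolynomial.monomial (e k) 1))
    have heval : ∀ c : Fin n → ℝ, MvPolynomial.eval (fun j => (c j : ℂ)) G =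
        φ ((∑ j, MvPolynomial.C (c j : ℂ) * MvPolynomial.X j) ^ m) := by
      intro c
      rw [Finset.sum_pow_eq_sum_piAntidiag, map_sum, map_sum]
      refine Finset.sum_congr rfl fun k _ => ?_
      have hterm : ((Nat.multinomial Finset.univ k : ℕ) : MvPolynomial (Fin n) ℂ) *
          ∏ j, (MvPolynomial.C (c j : ℂ) * MvPolynomial.X j) ^ k j =
          ((Nat.multinomial Finset.univ k : ℂ) * ∏ j, (c j : ℂ) ^ k j) •
            MvPolynomial.monomial (e k) 1 := by
        rw [MvPolynomial.smul_eq_C_mul, MvPolynomial.monomial_eq, Finsupp.prod_fintype]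
        · simp [mul_pow, Finset.prod_mul_distrib, e]
          ring
        · simp
      rw [hterm, map_smul, MvPolynomial.eval_monomial, Finsupp.prod_fintype]
      · simp [e]
        ring
      · simp
    have hzero : G * MvPolynomial.map Complex.ofRealHom f = 0 := by
      refine MvPolynomial.funext_set (fun _ => Set.range ((↑) : ℝ → ℂ))
        (fun _ => Set.infinite_range_of_injective Complex.ofReal_injective) fun x hx => ?_
      choose c hc using fun j => hx j (Set.mem_univ j)
      obtain rfl : (fun j => (c j : ℂ)) = x := funext hc
      have hmap : MvPolynomial.eval (fun j => (c j : ℂ)) (MvPolynomial.map Complex.ofRealHom f) =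
          (MvPolynomial.eval c f : ℂ) := by
        rw [MvPolynomial.eval_map]
        exact (MvPolynomial.eval₂_comp_left Complex.ofRealHom (RingHom.id ℝ) c f).symm
      rw [map_mul, map_zero, heval, hmap]
      by_cases h : MvPolynomial.eval c f = 0
      · rw [h, Complex.ofReal_zero, mul_zero]
      · rw [hφ _ (Submodule.subset_span ⟨m, hs, c, h, rfl⟩), zero_mul]
    have hG : G = 0 := by
      refine (mul_eq_zero.1 hzero).resolve_right fun h => hf ?_
      exact MvPolynomial.map_injective _ Complex.ofRealHom.injective (by rw [h, map_zero])
    have hcoeff := congrArg (MvPolynomial.coeff s) hG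
    rw [MvPolynomial.coeff_sum, Finset.sum_eq_single (s : Fin n → ℕ)] at hcoeff
    · have hes : e s = s := Finsupp.equivFunOnFinite.symm_apply_apply s
      rw [hes, MvPolynomial.coeff_monomial, if_pos rfl, MvPolynomial.coeff_zero] at hcoeff
      refine (mul_eq_zero.1 hcoeff).resolve_left ?_
      exact_mod_cast (Nat.multinomial_pos _ _).ne'
    · intro k _ hk
      rw [MvPolynomial.coeff_monomial, if_neg]
      rintro rfl
      exact hk (by simp [e])
    · intro h
      exact absurd (Finset.mem_piAntidiag.2 ⟨rfl, fun _ _ => Finset.mem_univ _⟩) h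
  rw [p.as_sum, map_sum]
  refine Finset.sum_eq_zero fun s hs => ?_
  rw [← mul_one (p.coeff s), ← smul_eq_mul, ← MvPolynomial.smul_monomial, map_smul, hmon s,
    smul_zero]
  have h := MvPolynomial.le_totalDegree hs
  rw [Finsupp.sum_fintype _ _ fun _ => rfl] at h
  exact h.trans hp

theorem exists_mvPolynomial_integral_eval {u : Fin d → Fin n → ℤ} {μ : Fin d → ℝ}
    {V : Finset (Fin n → ℝ)} (F : ∀ v : V, VertexFrame u μ v)
    (hctrl : ∀ᶠ ν in nhds μ, ControlledBy u μ V ν)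
    (hcomp : ∀ᶠ ν in nhds μ, IsCompact (polyhedron u ν))
    (hrec : ∀ z : Fin n → ℝ, z ≠ 0 → ∃ i, 0 < facetMap u z i)
    {L : Finset (Fin n → ℤ)} (hL : ∀ x : Fin n → ℤ, (fun j => (x j : ℝ)) ∈ polyhedron u μ → x ∈ L)
    (q : ℂ) {D : ℕ} {p : MvPolynomial (Fin n) ℂ} (hp : p.totalDegree ≤ D) :
    ∃ P : MvPolynomial (Fin d) ℂ,
      (∀ᶠ h in nhds (0 : Fin d → ℝ),
        ∫ x in polyhedron u (fun i => μ i + h i), MvPolynomial.eval (fun j => (x j : ℂ)) p =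
          MvPolynomial.eval (fun i => (h i : ℂ)) P) ∧
      ∀ N, D + n < N →
        ∑ x ∈ L, (∏ i, facetWeight q (facetMap u (fun j => (x j : ℝ)) i + μ i)) *
            MvPolynomial.eval (fun j => (x j : ℂ)) p =
          ∑ j ∈ Fintype.piFinset (fun _ : Fin d => Finset.range N), (∏ i, chiCoeff q (j i)) *
            mixedPartial j (fun h => MvPolynomial.eval (fun i => (h i : ℂ)) P) 0 := by
  have htendsto : Filter.Tendsto (fun h : Fin d → ℝ => fun i => μ i + h i) (nhds 0) (nhds μ) := by
    have : Continuous fun h : Fin d → ℝ => fun i => μ i + h i := by fun_prop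
    simpa using this.tendsto 0
  have hT : ∀ N, ∃ T : MvPolynomial (Fin d) ℂ →ₗ[ℂ] ℂ, ∀ P, T P =
      ∑ j ∈ Fintype.piFinset (fun _ : Fin d => Finset.range N), (∏ i, chiCoeff q (j i)) *
        mixedPartial j (fun h : Fin d → ℝ => MvPolynomial.eval (fun i => (h i : ℂ)) P) 0 :=
    fun N => exists_linearMap_mixedPartial _ _
  choose T hT using hT
  simp only [← hT]
  have hint : ∀ p : MvPolynomial (Fin n) ℂ, ∀ᶠ h in nhds (0 : Fin d → ℝ),
      IntegrableOn (fun x : Fin n → ℝ => MvPolynomial.eval (fun j => (x j : ℂ)) p)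
        (polyhedron u (fun i => μ i + h i)) := by
    intro p
    have hcont : Continuous fun x : Fin n → ℝ => MvPolynomial.eval (fun j => (x j : ℂ)) p :=
      (MvPolynomial.continuous_eval p).comp (by fun_prop)
    filter_upwards [htendsto.eventually hcomp] with h hh
    exact hcont.continuousOn.integrableOn_compact hh
  let f : MvPolynomial (Fin n) ℝ :=
    ∏ v, ∏ k, ∑ j, MvPolynomial.C ((F v).dualVec k j) * MvPolynomial.X j
  have hf : f ≠ 0 := by
    refine Finset.prod_ne_zero_iff.2 fun v _ => Finset.prod_ne_zero_iff.2 fun k _ h => ?_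
    refine (F v).dualVec_ne_zero k (funext fun j => ?_)
    have := congrArg (MvPolynomial.eval (Pi.single j 1)) h
    simpa [Pi.single_apply] using this
  refine Submodule.span_induction (p := fun p _ => ∃ P : MvPolynomial (Fin d) ℂ,
      (∀ᶠ h in nhds (0 : Fin d → ℝ),
        ∫ x in polyhedron u (fun i => μ i + h i), MvPolynomial.eval (fun j => (x j : ℂ)) p =
          MvPolynomial.eval (fun i => (h i : ℂ)) P) ∧
      ∀ N, D + n < N →
        ∑ x ∈ L, (∏ i, facetWeight q (facetMap u (fun j => (x j : ℝ)) i + μ i)) *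
            MvPolynomial.eval (fun j => (x j : ℂ)) p = T N P)
    ?_ ?_ ?_ ?_ (mem_span_linearForm_pow hf hp)
  · rintro _ ⟨m, hm, c, hc, rfl⟩
    let ζ : (Fin n → ℝ) →ₗ[ℝ] ℝ := ∑ j, c j • LinearMap.proj j
    have hζ_apply : ∀ x, ζ x = ∑ j, c j * x j := fun x => by simp [ζ]
    have hζ : ∀ v k, ζ ((F v).dualVec k) ≠ 0 := by
      intro v k
      rw [map_prod, Finset.prod_ne_zero_iff] at hc
      have hv := hc v (Finset.mem_univ v)
      rw [map_prod, Finset.prod_ne_zero_iff] at hv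
      have := hv k (Finset.mem_univ k)
      rw [hζ_apply]
      simpa [mul_comm] using this
    obtain ⟨P, h1, h2⟩ := exists_mvPolynomial_integral_pow F hctrl hcomp hrec hL hζ q m
    have heval : ∀ x : Fin n → ℝ, MvPolynomial.eval (fun j => (x j : ℂ))
        ((∑ j, MvPolynomial.C (c j : ℂ) * MvPolynomial.X j) ^ m) =
        ((-1) ^ m * m.factorial) * ((-(ζ x : ℂ)) ^ m / m.factorial) := by
      intro x
      have hm0 : (m.factorial : ℂ) ≠ 0 := by exact_mod_cast m.factorial_ne_zero
      rw [mul_assoc, mul_div_cancel₀ _ hm0, ← mul_pow, hζ_apply]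
      simp
    refine ⟨((-1) ^ m * m.factorial : ℂ) • P, ?_, fun N hN => ?_⟩
    · filter_upwards [h1] with h hh
      simp only [heval]
      rw [integral_const_mul, hh, MvPolynomial.smul_eval]
    · have h3 := h2 N (by omega)
      rw [← hT] at h3
      rw [map_smul, ← h3, smul_eq_mul, Finset.mul_sum]
      refine Finset.sum_congr rfl fun x _ => ?_
      have := heval fun j => (x j : ℝ)
      push_cast at this
      rw [this]
      ring
  · exact ⟨0, by simp, by simp⟩
  · rintro p p' - - ⟨P, h1, h2⟩ ⟨P', h1', h2'⟩
    refine ⟨P + P', ?_, fun N hN => ?_⟩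
    · filter_upwards [h1, h1', hint p, hint p'] with h hh hh' hi hi'
      simp only [map_add]
      rw [integral_add hi hi', hh, hh']
    · rw [map_add, ← h2 N hN, ← h2' N hN, ← Finset.sum_add_distrib]
      exact Finset.sum_congr rfl fun x _ => by rw [map_add, mul_add]
  · rintro a p - ⟨P, h1, h2⟩
    refine ⟨a • P, ?_, fun N hN => ?_⟩
    · filter_upwards [h1] with h hh
      simp only [MvPolynomial.smul_eval]
      rw [integral_const_mul, hh]
    · rw [map_smul, ← h2 N hN, smul_eq_mul, Finset.mul_sum]
      exact Finset.sum_congr rfl fun x _ => by rw [MvPolynomial.smul_eval]; ring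

end Assembly

/-- **Exact weighted Euler–Maclaurin for regular integral polytopes and polynomials.**
Let `Δ = ∩ᵢ {x : ⟨uᵢ,x⟩ + μᵢ ≥ 0} ⊂ ℝⁿ` be a regular integral polytope (compact, with
nonempty interior, primitive normals, facets of affine dimension `n-1`, vertex set
`V ⊂ ℤⁿ`, each vertex on exactly `n` facet hyperplanes whose normals form a ℤ-basis of
`ℤⁿ`), `q ∈ ℂ` and `p` a polynomial on `ℝⁿ`.  Then `H(h) := ∫_{Δ(h)} p` agrees with a
polynomial in `h` near `0`, and for every integer `K` with `2K ≥ deg p + n + 1`,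
`∑_{x∈Δ∩ℤⁿ} q^{c(x)} p(x) = [∏ᵢ χ_q^{2K}(∂/∂hᵢ)] H |_{h=0}`. -/
theorem exact_weighted_euler_maclaurin_regular_polytope
    (n d : ℕ) (u : Fin d → Fin n → ℤ) (μ : Fin d → ℝ) (q : ℂ)
    (hcomp : IsCompact {x : Fin n → ℝ | ∀ i, 0 ≤ intPair (u i) x + μ i})
    (hint : (interior {x : Fin n → ℝ | ∀ i, 0 ≤ intPair (u i) x + μ i}).Nonempty)
    (hprim : ∀ i, ¬∃ m : ℤ, 1 < m ∧ ∃ w : Fin n → ℤ, ∀ j, u i j = m * w j)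
    (hfacet : ∀ i, Module.finrank ℝ
      (affineSpan ℝ ({x : Fin n → ℝ | ∀ i', 0 ≤ intPair (u i') x + μ i'} ∩
        {x : Fin n → ℝ | intPair (u i) x + μ i = 0})).direction = n - 1)
    (V : Finset (Fin n → ℝ))
    (hV : (V : Set (Fin n → ℝ)) =
      Set.extremePoints ℝ {x : Fin n → ℝ | ∀ i, 0 ≤ intPair (u i) x + μ i})
    (hVint : ∀ v ∈ V, ∃ g : Fin n → ℤ, v = fun j => (g j : ℝ))
    (hreg : ∀ v ∈ V,
      (Finset.univ.filter fun i => intPair (u i) v + μ i = 0).card = n ∧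
      Submodule.span ℤ {w : Fin n → ℤ | ∃ i, intPair (u i) v + μ i = 0 ∧ w = u i} = ⊤)
    (p : MvPolynomial (Fin n) ℂ) :
    (∃ P : MvPolynomial (Fin d) ℂ,
      ∀ᶠ h in nhds (0 : Fin d → ℝ),
        (∫ x in {x : Fin n → ℝ | ∀ i, 0 ≤ intPair (u i) x + μ i + h i},
          MvPolynomial.eval (fun j => ((x j : ℝ) : ℂ)) p) =
        MvPolynomial.eval (fun i => ((h i : ℝ) : ℂ)) P) ∧
    ∀ K : ℕ, p.totalDegree + n + 1 ≤ 2 * K →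
      (∑' x : Fin n → ℤ,
        (if ∀ i, 0 ≤ intPair (u i) (fun j => (x j : ℝ)) + μ i then
          q ^ (Finset.univ.filter fun i =>
            intPair (u i) (fun j => (x j : ℝ)) + μ i = 0).card
        else 0) * MvPolynomial.eval (fun j => ((x j : ℂ))) p) =
      ∑ j ∈ Fintype.piFinset (fun _ : Fin d => Finset.range (2 * K + 1)),
        (∏ i, chiCoeff q (j i)) *
          mixedPartial j
            (fun h : Fin d → ℝ =>
              ∫ x in {x : Fin n → ℝ | ∀ i, 0 ≤ intPair (u i) x + μ i + h i},
                MvPolynomial.eval (fun j' => ((x j' : ℝ) : ℂ)) p) 0 := by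
  have hu : ∀ i, u i ≠ 0 := fun i hi =>
    hprim i ⟨2, one_lt_two, 0, fun j => by rw [hi, Pi.zero_apply, mul_zero]⟩
  obtain ⟨x₀, hx₀⟩ := exists_forall_pos_slack (ν := μ) hu hint
  have hrec := exists_facetMap_pos (ν := μ) hcomp ⟨x₀, mem_polyhedron.2 fun i => (hx₀ i).le⟩
  let F : ∀ v : V, VertexFrame u μ v := fun v =>
    (nonempty_vertexFrame (hVint v v.2) (hreg v v.2).1 (hreg v v.2).2).some
  have hctrl := eventually_controlledBy hcomp hx₀ hV fun v hv => F ⟨v, hv⟩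
  have hcompact : ∀ᶠ ν in nhds μ, IsCompact (polyhedron u ν) := by
    obtain ⟨R, hR⟩ := exists_eventually_norm_le hcomp hx₀
    filter_upwards [hR] with ν hν
    exact Metric.isCompact_of_isClosed_isBounded (isClosed_polyhedron u ν)
      (isBounded_iff_forall_norm_le.2 ⟨R, hν⟩)
  obtain ⟨R, hR⟩ := hcomp.isBounded.exists_norm_le
  let L : Finset (Fin n → ℤ) := Fintype.piFinset fun _ => Finset.Icc (-⌈R⌉) ⌈R⌉
  have hL : ∀ x : Fin n → ℤ, (fun j => (x j : ℝ)) ∈ polyhedron u μ → x ∈ L := by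
    intro x hx
    refine Fintype.mem_piFinset.2 fun j => Finset.mem_Icc.2 (abs_le.1 ?_)
    have h1 := (norm_le_pi_norm (fun j => (x j : ℝ)) j).trans (hR _ hx)
    have h2 : ((|x j| : ℤ) : ℝ) ≤ R := by rw [Int.cast_abs, ← Real.norm_eq_abs]; exact h1
    exact_mod_cast h2.trans (Int.le_ceil R)
  obtain ⟨P, hP, hsum⟩ := exists_mvPolynomial_integral_eval F hctrl hcompact hrec hL q le_rfl
    (p := p)
  have hset : ∀ h : Fin d → ℝ, {x : Fin n → ℝ | ∀ i, 0 ≤ intPair (u i) x + μ i + h i} =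
      polyhedron u (fun i => μ i + h i) := fun h => by
    simp only [polyhedron, add_assoc]
  simp only [hset]
  refine ⟨⟨P, hP⟩, fun K hK => ?_⟩
  rw [tsum_eq_sum (s := L) fun x hx => mul_eq_zero_of_left (if_neg fun h => hx (hL x h)) _]
  simp only [← prod_facetWeight]
  rw [hsum (2 * K + 1) (by omega)]
  exact Finset.sum_congr rfl fun j _ => by rw [mixedPartial_congr j hP]
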